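/- Let R be a one-dimensional Gorenstein local ring with e(R) ≤ 6 and let I be a faithful ideal of R. If I ⊗_R Hom_R(I, R) is torsionfree, then I is a principal ideal. -/

import Mathlib

open CategoryTheory TensorProduct

noncomputable section

/-- Minimal number of generators of a submodule. -/
def minGen (R : Type*) {M : Type*} [Semiring R] [AddCommMonoid M] [Module R M]
    (p : Submodule R M) : ℕ :=
  sInf {n | ∃ s : Finset M, s.card = n ∧ Submodule.span R (s : Set M) = p}

/-- Length of a module, as the height of `⊤` in its lattice of submodules. -/
def moduleLength (R M : Type*) [Ring R] [AddCommGroup M] [Module R M] : ℕ∞ :=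
  Order.height (⊤ : Submodule R M)

/-- `e` is the (Hilbert–Samuel) multiplicity of the one-dimensional local ring `(R, m)`:
the first difference of the Hilbert–Samuel function `n ↦ ℓ_R(R/mⁿ)` is eventually
equal to `e`. -/
def IsMultiplicityAt (R : Type*) [CommRing R] (m : Ideal R) (e : ℕ) : Prop :=
  ∃ N : ℕ, ∀ n ≥ N,
    moduleLength R (R ⧸ (m ^ (n + 1))) = moduleLength R (R ⧸ (m ^ n)) + e

/-- The `i`-th Ext module `Ext_R^i(M, N)`. -/
def extMod (R : Type u) [CommRing R] (M N : ModuleCat.{u} R) (i : ℕ) : ModuleCat R :=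
  ((Ext R (ModuleCat.{u} R) i).obj (Opposite.op M)).obj N

/-- `K` is a canonical module of the one-dimensional Cohen–Macaulay local ring `R` with
maximal ideal `m`, via the Bass-number characterization:
`Ext^i(R/m, K) = 0` for `i ≠ 1` and `Ext^1(R/m, K) ≅ R/m`. -/
def IsCanonicalModuleAt (R : Type u) [CommRing R] (m : Ideal R)
    (K : Type u) [AddCommGroup K] [Module R K] : Prop :=
  Module.Finite R K ∧
  (∀ i : ℕ, i ≠ 1 →
    Subsingleton (extMod R (ModuleCat.of R (R ⧸ m)) (ModuleCat.of R K) i)) ∧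
  Nonempty ((extMod R (ModuleCat.of R (R ⧸ m)) (ModuleCat.of R K) 1) ≅
    ModuleCat.of R (R ⧸ m))

/-- The evaluation map `I ⊗_R Hom_R(I, K) → K`, `x ⊗ f ↦ f x`. -/
def evalMap (R : Type*) [CommRing R] {M : Type*} [AddCommGroup M] [Module R M]
    (I : Submodule R M) (K : Type*) [AddCommGroup K] [Module R K] :
    (I ⊗[R] (I →ₗ[R] K)) →ₗ[R] K :=
  TensorProduct.lift LinearMap.applyₗ

/-- A fractional ideal `I` of `R` with `FI = F`: a finitely generated `R`-submodule of the
total ring of fractions `F = Q(R)` containing a unit of `F`. -/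
def IsFracIdealUnit (R : Type*) [CommRing R] (I : Submodule R (FractionRing R)) : Prop :=
  I.FG ∧ ∃ x ∈ I, IsUnit x

/-- A one-dimensional Cohen–Macaulay local ring: Noetherian, local, Krull dimension one,
and the maximal ideal contains a nonzerodivisor. -/
def IsOneDimCMLocal (R : Type*) [CommRing R] [IsLocalRing R] : Prop :=
  IsNoetherianRing R ∧ ringKrullDim R = 1 ∧
    ∃ x ∈ IsLocalRing.maximalIdeal R, x ∈ nonZeroDivisors R

/-- The colon `M : N = {x ∈ A | x N ⊆ M}` of two `R`-submodules of an `R`-algebra `A`,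
as an `R`-submodule of `A`. -/
def colonSub {R A : Type*} [CommRing R] [CommRing A] [Algebra R A]
    (M N : Submodule R A) : Submodule R A where
  carrier := {x : A | ∀ y ∈ N, x * y ∈ M}
  add_mem' := fun {a b} ha hb y hy => by
    rw [add_mul]; exact M.add_mem (ha y hy) (hb y hy)
  zero_mem' := fun y hy => by rw [zero_mul]; exact M.zero_mem
  smul_mem' := fun c {x} hx y hy => by
    rw [smul_mul_assoc]; exact M.smul_mem c (hx y hy)


section

open IsLocalRing

open scoped Pointwise

/-- A cocycle in the `Hom` complex of a projective resolution is a coboundary as soon as the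
corresponding `Ext` module vanishes. -/
theorem exists_comp_eq_of_subsingleton_extMod {R : Type u} [CommRing R] {X Y : ModuleCat.{u} R}
    (P : ProjectiveResolution X) (n : ℕ) (h : Subsingleton (extMod R X Y (n + 1)))
    (φ : P.complex.X (n + 1) ⟶ Y) (hφ : P.complex.d (n + 2) (n + 1) ≫ φ = 0) :
    ∃ ψ : P.complex.X n ⟶ Y, P.complex.d (n + 1) n ≫ ψ = φ := by
  have h1 : Limits.IsZero ((P.complex.linearYonedaObj R Y).homology (n + 1)) :=
    (ModuleCat.isZero_of_subsingleton (extMod R X Y (n + 1))).of_iso (P.isoExt (n + 1) Y).symm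
  rw [← HomologicalComplex.exactAt_iff_isZero_homology,
    HomologicalComplex.exactAt_iff' _ n (n + 1) (n + 2) (by simp) (by simp),
    ShortComplex.moduleCat_exact_iff] at h1
  exact h1 φ hφ

theorem eq_zero_of_subsingleton_extMod_zero {R : Type u} [CommRing R] {X Y : ModuleCat.{u} R}
    (h : Subsingleton (extMod R X Y 0)) (f : X ⟶ Y) : f = 0 := by
  let P := projectiveResolution X
  have h1 : Limits.IsZero ((P.complex.linearYonedaObj R Y).homology 0) :=
    (ModuleCat.isZero_of_subsingleton (extMod R X Y 0)).of_iso (P.isoExt 0 Y).symm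
  rw [← HomologicalComplex.exactAt_iff_isZero_homology,
    HomologicalComplex.exactAt_iff' _ 0 0 1 (by simp) (by simp),
    ShortComplex.moduleCat_exact_iff] at h1
  obtain ⟨ψ, hψ⟩ := h1 (P.π.f 0 ≫ f) (by
    exact (Category.assoc _ _ _).symm.trans
      ((congrArg (· ≫ f) P.complex_d_comp_π_f_zero).trans Limits.zero_comp))
  have h2 : P.complex.d 0 0 ≫ ψ = P.π.f 0 ≫ f := hψ
  have h3 : P.π.f 0 ≫ f = 0 := h2.symm.trans
    ((congrArg (· ≫ (show P.complex.X 0 ⟶ Y from ψ)) (P.complex.shape 0 0 (by simp))).trans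
      Limits.zero_comp)
  exact (cancel_epi (P.π.f 0)).1 (h3.trans Limits.comp_zero.symm)

theorem eq_zero_of_forall_maximalIdeal_mul_eq_zero {R : Type u} [CommRing R] [IsLocalRing R]
    (h : Subsingleton (extMod R (ModuleCat.of R (R ⧸ maximalIdeal R)) (ModuleCat.of R R) 0))
    {x : R} (hx : ∀ c ∈ maximalIdeal R, c * x = 0) : x = 0 := by
  let f : (R ⧸ maximalIdeal R) →ₗ[R] R :=
    Submodule.liftQ (maximalIdeal R) (LinearMap.toSpanSingleton R R x)
      (fun c hc => by simpa using hx c hc)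
  have h1 := eq_zero_of_subsingleton_extMod_zero h (ModuleCat.ofHom f)
  have h2 : f (Submodule.Quotient.mk 1) = 0 := by
    change (ModuleCat.ofHom f).hom (Submodule.Quotient.mk 1) = 0
    rw [h1]; rfl
  rwa [Submodule.liftQ_apply, LinearMap.toSpanSingleton_apply, one_smul] at h2

/-- A linear map descends along a surjection whose kernel it kills. -/
theorem LinearMap.exists_apply_eq_of_ker_le {R M N P : Type*} [CommRing R] [AddCommGroup M]
    [AddCommGroup N] [AddCommGroup P] [Module R M] [Module R N] [Module R P] {π : M →ₗ[R] N}
    (hπ : Function.Surjective π) (g : M →ₗ[R] P) (h : ∀ x, π x = 0 → g x = 0) :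
    ∃ f : N →ₗ[R] P, ∀ x, f (π x) = g x := by
  refine ⟨(LinearMap.ker π).liftQ g (fun x hx => h x hx) ∘ₗ
    (π.quotKerEquivOfSurjective hπ).symm.toLinearMap,
    fun x => ?_⟩
  have : (π.quotKerEquivOfSurjective hπ).symm (π x) = Submodule.Quotient.mk x := by
    rw [LinearEquiv.symm_apply_eq]; rfl
  rw [LinearMap.comp_apply, LinearEquiv.coe_coe, this]
  rfl

/-- Suppose `P₃ → P₂ → P₁ → P₀` is part of a projective resolution on which every cocycle
`P₂ → R` is a coboundary. Then homomorphisms to `R/a`, with `a` a nonzerodivisor, lift from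
the image of `P₁` in `P₀` to `R`. -/
theorem exists_lift_mod_of_comp_eq {R : Type*} [CommRing R] {P₀ P₁ P₂ P₃ : Type*}
    [AddCommGroup P₀] [AddCommGroup P₁] [AddCommGroup P₂] [AddCommGroup P₃]
    [Module R P₀] [Module R P₁] [Module R P₂] [Module R P₃] [Module.Projective R P₁]
    (d₁ : P₁ →ₗ[R] P₀) (d₂ : P₂ →ₗ[R] P₁) (d₃ : P₃ →ₗ[R] P₂)
    (h₁₂ : Function.Exact d₂ d₁) (h₂₃ : d₂ ∘ₗ d₃ = 0)
    (hext : ∀ φ : P₂ →ₗ[R] R, φ ∘ₗ d₃ = 0 → ∃ ψ : P₁ →ₗ[R] R, ψ ∘ₗ d₂ = φ)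
    {a : R} (ha : a ∈ nonZeroDivisors R) (h : LinearMap.range d₁ →ₗ[R] R ⧸ Ideal.span {a}) :
    ∃ g : LinearMap.range d₁ →ₗ[R] R, ∀ x, Ideal.Quotient.mk _ (g x) = h x := by
  obtain ⟨F, hF⟩ := Module.projective_lifting_property (Submodule.mkQ (Ideal.span {a}))
    (h ∘ₗ d₁.rangeRestrict) (Submodule.mkQ_surjective _)
  have hF' : ∀ p, Submodule.mkQ (Ideal.span {a}) (F p) = h (d₁.rangeRestrict p) :=
    fun p => LinearMap.congr_fun hF p
  have h1 : ∀ p, ∃ y, F (d₂ p) = a * y := by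
    intro p
    have : Submodule.mkQ (Ideal.span {a}) (F (d₂ p)) = 0 := by
      rw [hF', show d₁.rangeRestrict (d₂ p) = 0 from
        Subtype.ext (by simpa using h₁₂.apply_apply_eq_zero p), map_zero]
    rw [Submodule.mkQ_apply, Submodule.Quotient.mk_eq_zero, Ideal.mem_span_singleton] at this
    exact this
  choose φ hφ using h1
  have inj : ∀ {x y : R}, a * x = a * y → x = y :=
    fun h => (mul_cancel_left_mem_nonZeroDivisors ha).1 h
  let Φ : P₂ →ₗ[R] R :=
    { toFun := φ
      map_add' := fun x y => inj (by rw [← hφ, mul_add, ← hφ, ← hφ]; simp)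
      map_smul' := fun c x => inj (by
        rw [← hφ]; simp only [map_smul, hφ, smul_eq_mul, RingHom.id_apply]; ring) }
  obtain ⟨ψ, hψ⟩ := hext Φ (by
    ext p
    refine inj ?_
    change a * φ (d₃ p) = a * 0
    rw [← hφ, show d₂ (d₃ p) = 0 from LinearMap.congr_fun h₂₃ p]; simp)
  have hker : ∀ p, d₁.rangeRestrict p = 0 → (F - a • ψ) p = 0 := by
    intro p hp
    obtain ⟨q, rfl⟩ := (h₁₂ p).1 (by simpa using congrArg Subtype.val hp)
    have : ψ (d₂ q) = φ q := LinearMap.congr_fun hψ q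
    simp [this, hφ]
  obtain ⟨g, hg⟩ := LinearMap.exists_apply_eq_of_ker_le d₁.surjective_rangeRestrict _ hker
  refine ⟨g, fun x => ?_⟩
  obtain ⟨p, rfl⟩ := d₁.surjective_rangeRestrict x
  rw [hg, ← hF']
  simp only [LinearMap.sub_apply, LinearMap.smul_apply, smul_eq_mul, map_sub, Submodule.mkQ_apply,
    Ideal.Quotient.mk_eq_mk]
  rw [sub_eq_self, Ideal.Quotient.eq_zero_iff_mem]
  exact Ideal.mul_mem_right _ _ (Ideal.mem_span_singleton_self a)

/-- If `Ext²(R/m, R) = 0` and `a` is a nonzerodivisor, then every homomorphism `m → R/a`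
lifts to `R`. -/
theorem exists_lift_maximalIdeal {R : Type u} [CommRing R] [IsLocalRing R]
    (h : Subsingleton (extMod R (ModuleCat.of R (R ⧸ maximalIdeal R)) (ModuleCat.of R R) 2))
    {a : R} (ha : a ∈ nonZeroDivisors R) (f : maximalIdeal R →ₗ[R] R ⧸ Ideal.span {a}) :
    ∃ g : maximalIdeal R →ₗ[R] R, ∀ x, Ideal.Quotient.mk _ (g x) = f x := by
  let P := projectiveResolution (ModuleCat.of R (R ⧸ maximalIdeal R))
  let d₁ := (P.complex.d 1 0).hom
  let d₂ := (P.complex.d 2 1).hom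
  let d₃ := (P.complex.d 3 2).hom
  let ε : P.complex.X 0 →ₗ[R] R ⧸ maximalIdeal R := (P.π.f 0).hom
  have h₀ : Function.Exact d₁ ε := by
    have := (ShortComplex.ShortExact.moduleCat_exact_iff_function_exact _).1 P.exact₀
    exact this
  have h₁ : Function.Exact d₂ d₁ :=
    (ShortComplex.ShortExact.moduleCat_exact_iff_function_exact _).1 (P.exact_succ 0)
  have hε : Function.Surjective ε := (ModuleCat.epi_iff_surjective (P.π.f 0)).1 inferInstance
  have hP0 : Module.Projective R (P.complex.X 0) :=
    (IsProjective.iff_projective (R := R) (P.complex.X 0)).2 (P.projective 0)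
  have hP1 : Module.Projective R (P.complex.X 1) :=
    (IsProjective.iff_projective (R := R) (P.complex.X 1)).2 (P.projective 1)
  obtain ⟨α, hα⟩ := Module.projective_lifting_property (Submodule.mkQ (maximalIdeal R)) ε
    (Submodule.mkQ_surjective _)
  obtain ⟨β, hβ⟩ := Module.projective_lifting_property ε (Submodule.mkQ (maximalIdeal R)) hε
  have hα' : ∀ p ∈ LinearMap.range d₁, α p ∈ maximalIdeal R := by
    intro p hp
    rw [← Submodule.Quotient.mk_eq_zero]
    exact (LinearMap.congr_fun hα p).trans ((h₀ p).2 hp)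
  have hβ' : ∀ x ∈ maximalIdeal R, β x ∈ LinearMap.range d₁ := by
    intro x hx
    refine (h₀ _).1 ((LinearMap.congr_fun hβ x).trans ?_)
    exact (Submodule.Quotient.mk_eq_zero _).2 hx
  obtain ⟨G, hG⟩ := exists_lift_mod_of_comp_eq d₁ d₂ d₃ h₁
    (by rw [← ModuleCat.hom_comp, P.complex.d_comp_d]; rfl)
    (by
      intro φ hφ
      obtain ⟨ψ, hψ⟩ := exists_comp_eq_of_subsingleton_extMod P 1 h (ModuleCat.ofHom φ)
        (ModuleCat.hom_ext hφ)
      exact ⟨ψ.hom, by rw [← ModuleCat.hom_comp, hψ]; rfl⟩) ha (f ∘ₗ α.restrict hα')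
  have hu : IsUnit (α (β 1)) := by
    rw [← notMem_maximalIdeal, ← Submodule.Quotient.mk_eq_zero]
    have h1 : (Submodule.Quotient.mk (α (β 1)) : R ⧸ maximalIdeal R) = Submodule.Quotient.mk 1 :=
      (LinearMap.congr_fun hα _).trans (LinearMap.congr_fun hβ 1)
    rw [h1, Submodule.Quotient.mk_eq_zero]
    exact (Ideal.ne_top_iff_one _).1 Ideal.IsPrime.ne_top'
  obtain ⟨u, hu⟩ := hu
  refine ⟨(↑u⁻¹ : R) • G ∘ₗ β.restrict hβ', fun x => ?_⟩
  have h2 : α (β x) = u * (x : R) := by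
    have : β x = (x : R) • β 1 := by rw [← map_smul]; simp
    rw [this, map_smul, hu, smul_eq_mul, mul_comm]
  have h3 := hG (β.restrict hβ' x)
  rw [LinearMap.comp_apply, show α.restrict hα' (β.restrict hβ' x) = (u : R) • x from
    Subtype.ext h2, map_smul] at h3
  change (Submodule.Quotient.mk ((↑u⁻¹ : R) • _) : R ⧸ Ideal.span {a}) = _
  rw [Submodule.Quotient.mk_smul]
  change (↑u⁻¹ : R) • Ideal.Quotient.mk _ (G (β.restrict hβ' x)) = _
  rw [h3, smul_smul, Units.inv_mul, one_smul]

/-- Division of a linear form by a nonzerodivisor dividing all of its values. -/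
theorem LinearMap.exists_mul_apply_eq {R M : Type*} [CommRing R] [AddCommGroup M] [Module R M]
    {a : R} (ha : a ∈ nonZeroDivisors R) (f : M →ₗ[R] R) (h : ∀ x, a ∣ f x) :
    ∃ g : M →ₗ[R] R, ∀ x, f x = a * g x := by
  choose φ hφ using h
  have inj : ∀ {x y : R}, a * x = a * y → x = y :=
    fun h => (mul_cancel_left_mem_nonZeroDivisors ha).1 h
  exact ⟨{ toFun := φ
           map_add' := fun x y => inj (by rw [← hφ, mul_add, ← hφ, ← hφ, map_add])
           map_smul' := fun c x => inj (by
             rw [← hφ, map_smul, hφ, smul_eq_mul, smul_eq_mul, RingHom.id_apply]; ring) }, hφ⟩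

/-- A nonzero element killed by a power of the maximal ideal has a nonzero multiple in the
socle. -/
theorem exists_smul_ne_zero_and_forall_smul_eq_zero {R M : Type*} [CommRing R] [IsLocalRing R]
    [AddCommGroup M] [Module R M] {x : M} (hx : x ≠ 0) {n : ℕ}
    (hn : ∀ c ∈ maximalIdeal R ^ n, c • x = 0) :
    ∃ r : R, r • x ≠ 0 ∧ ∀ c ∈ maximalIdeal R, c • r • x = 0 := by
  induction n with
  | zero => exact absurd (by simpa using hn 1 (by simp)) hx
  | succ n ih =>
    by_cases h : ∀ c ∈ maximalIdeal R ^ n, c • x = 0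
    · exact ih h
    · push Not at h
      obtain ⟨r, hr, hrx⟩ := h
      refine ⟨r, hrx, fun c hc => ?_⟩
      rw [smul_smul]
      exact hn _ (by rw [pow_succ']; exact Ideal.mul_mem_mul hc hr)

theorem exists_notMem_and_forall_mul_mem {R : Type*} [CommRing R] [IsLocalRing R]
    {𝔞 : Ideal R} (h : 𝔞 ≠ ⊤) {n : ℕ} (hn : maximalIdeal R ^ n ≤ 𝔞) :
    ∃ w, w ∉ 𝔞 ∧ ∀ c ∈ maximalIdeal R, c * w ∈ 𝔞 := by
  obtain ⟨r, h1, h2⟩ := exists_smul_ne_zero_and_forall_smul_eq_zero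
    (R := R) (x := (Submodule.Quotient.mk 1 : R ⧸ 𝔞)) (n := n)
    (by rwa [Ne, Submodule.Quotient.mk_eq_zero, ← Ideal.eq_top_iff_one])
    (fun c hc => by
      rw [← Submodule.Quotient.mk_smul, Submodule.Quotient.mk_eq_zero, smul_eq_mul, mul_one]
      exact hn hc)
  refine ⟨r, fun hr => h1 ?_, fun c hc => ?_⟩
  · rw [← Submodule.Quotient.mk_smul, Submodule.Quotient.mk_eq_zero]
    simpa using hr
  · have := h2 c hc
    rw [← Submodule.Quotient.mk_smul, ← Submodule.Quotient.mk_smul,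
      Submodule.Quotient.mk_eq_zero] at this
    simpa using this

/-- The two consequences of being one-dimensional and Gorenstein from which the duality theory
of `R` is derived. -/
structure IsGorensteinDual (R : Type*) [CommRing R] [IsLocalRing R] : Prop where
  exists_lift {a : R} (ha : a ∈ nonZeroDivisors R)
    (f : maximalIdeal R →ₗ[R] R ⧸ Ideal.span {a}) :
    ∃ g : maximalIdeal R →ₗ[R] R, ∀ x, Ideal.Quotient.mk _ (g x) = f x
  pow_le {a : R} (ha : a ∈ nonZeroDivisors R) : ∃ n, maximalIdeal R ^ n ≤ Ideal.span {a}

theorem mul_apply_eq_mul_apply {R : Type*} [CommRing R] {I : Ideal R} (f : I →ₗ[R] R) (x y : I) :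
    (x : R) * f y = y * f x := by
  have : (x : R) • y = (y : R) • x := Subtype.ext (mul_comm _ _)
  simpa using congrArg f this

section Duality

variable {R : Type*} [CommRing R] [IsLocalRing R] [IsNoetherianRing R]

/-- The self-duality of `R/a` for a nonzerodivisor `a` of a one-dimensional Gorenstein local
ring: a homomorphism from an ideal containing `a` to `R/a` that kills `a` is a multiplication. -/
theorem exists_forall_eq_mk_mul
    (hR : IsGorensteinDual R)
    {a : R} (ha : a ∈ nonZeroDivisors R) (𝔞 : Ideal R) (ha𝔞 : a ∈ 𝔞)
    (h : 𝔞 →ₗ[R] R ⧸ Ideal.span {a}) (h0 : h ⟨a, ha𝔞⟩ = 0) :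
    ∃ c : R, ∀ x : 𝔞, h x = Ideal.Quotient.mk _ (c * x) := by
  induction 𝔞 using WellFoundedGT.induction with
  | ind 𝔞 ih =>
  by_cases htop : 𝔞 = ⊤
  · obtain ⟨c, hc⟩ := Ideal.Quotient.mk_surjective (h ⟨1, htop ▸ Submodule.mem_top⟩)
    refine ⟨c, fun x => ?_⟩
    have : x = (x : R) • (⟨1, htop ▸ Submodule.mem_top⟩ : 𝔞) := Subtype.ext (by simp)
    rw [mul_comm c]
    conv_lhs => rw [this]
    rw [map_smul, ← hc]
    rfl
  obtain ⟨n, hn⟩ := hR.pow_le ha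
  obtain ⟨w, hw, hmw⟩ := exists_notMem_and_forall_mul_mem htop
    (hn.trans ((Ideal.span_singleton_le_iff_mem _).2 ha𝔞))
  have ham : a ∈ maximalIdeal R := le_maximalIdeal htop ha𝔞
  let f : maximalIdeal R →ₗ[R] 𝔞 := (LinearMap.mulRight R w).restrict hmw
  obtain ⟨g, hg⟩ := hR.exists_lift ha (h ∘ₗ f)
  have hga : a ∣ g ⟨a, ham⟩ := by
    rw [← Ideal.Quotient.eq_zero_iff_dvd, hg, LinearMap.comp_apply,
      show f ⟨a, ham⟩ = w • (⟨a, ha𝔞⟩ : 𝔞) from Subtype.ext (mul_comm _ _), map_smul, h0, smul_zero]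
  obtain ⟨y, hy⟩ := hga
  have hgx : ∀ x : maximalIdeal R, g x = x * y := by
    intro x
    refine (mul_cancel_left_mem_nonZeroDivisors ha).1 ?_
    have : a • x = (x : R) • (⟨a, ham⟩ : maximalIdeal R) := Subtype.ext (mul_comm _ _)
    have h2 := congrArg g this
    rw [map_smul, map_smul, hy, smul_eq_mul, smul_eq_mul] at h2
    rw [h2]; ring
  let π : 𝔞 × R →ₗ[R] ↥(𝔞 ⊔ Ideal.span {w}) :=
    LinearMap.codRestrict _ (LinearMap.coprod 𝔞.subtype (LinearMap.mulRight R w)) (fun p =>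
      Submodule.add_mem_sup p.1.2 (Ideal.mul_mem_left _ _ (Ideal.mem_span_singleton_self w)))
  have hπv : ∀ p, (π p : R) = p.1 + p.2 * w := fun p => rfl
  have hπ : Function.Surjective π := by
    rintro ⟨x, hx⟩
    obtain ⟨y, hy, z, hz, rfl⟩ := Submodule.mem_sup.1 hx
    obtain ⟨r, rfl⟩ := Ideal.mem_span_singleton'.1 hz
    exact ⟨(⟨y, hy⟩, r), rfl⟩
  obtain ⟨h', hh'⟩ := LinearMap.exists_apply_eq_of_ker_le hπ
    (LinearMap.coprod h (LinearMap.toSpanSingleton R (R ⧸ Ideal.span {a}) (Ideal.Quotient.mk _ y)))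
    (by
      rintro ⟨z, r⟩ hzr
      have h1 : (z : R) + r * w = 0 := congrArg Subtype.val hzr
      have hr : r ∈ maximalIdeal R := by
        by_contra hr
        obtain ⟨u, rfl⟩ := notMem_maximalIdeal.1 hr
        refine hw ?_
        have : w = -(↑u⁻¹ * (z : R)) := by
          rw [eq_neg_of_add_eq_zero_left h1]; simp
        rw [this]
        exact 𝔞.neg_mem (𝔞.mul_mem_left _ z.2)
      have h2 : z = - f ⟨r, hr⟩ := Subtype.ext (eq_neg_of_add_eq_zero_left h1)
      have h3 := hg ⟨r, hr⟩
      rw [hgx, LinearMap.comp_apply] at h3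
      rw [LinearMap.coprod_apply, h2, map_neg, ← h3, LinearMap.toSpanSingleton_apply]
      exact neg_add_cancel _)
  have hlt : 𝔞 < 𝔞 ⊔ Ideal.span {w} := by
    refine lt_of_le_of_ne le_sup_left fun he => hw ?_
    rw [he]
    exact Ideal.mem_sup_right (Ideal.mem_span_singleton_self w)
  have key : ∀ z : 𝔞, h' ⟨z, hlt.le z.2⟩ = h z := by
    intro z
    have := hh' (z, 0)
    rw [LinearMap.coprod_apply, map_zero, add_zero] at this
    rw [← this]
    congr 1
    exact Subtype.ext (by simp [hπv])
  obtain ⟨c, hc⟩ := ih _ hlt (hlt.le ha𝔞) h' ((key ⟨a, ha𝔞⟩).trans h0)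
  exact ⟨c, fun x => by rw [← key, hc]⟩

/-- Relative injectivity: a homomorphism `U → R/a` from a subideal `U` of `I` which kills
`aI` extends to `I` and lifts to `R`. -/
theorem exists_lift_extend
    (hR : IsGorensteinDual R)
    {a b : R} (ha : a ∈ nonZeroDivisors R) (hb : b ∈ nonZeroDivisors R) {I U : Ideal R}
    (hbI : b ∈ I) (hUI : U ≤ I) (haI : ∀ x ∈ I, a * x ∈ U)
    (h : U →ₗ[R] R ⧸ Ideal.span {a}) (h0 : ∀ (x : R) (hx : x ∈ I), h ⟨a * x, haI x hx⟩ = 0) :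
    ∃ g : I →ₗ[R] R, ∀ x : U, Ideal.Quotient.mk _ (g ⟨x, hUI x.2⟩) = h x := by
  let μ : (R ⧸ Ideal.span {a}) →ₗ[R] R ⧸ Ideal.span {a * b} :=
    Submodule.mapQ _ _ (LinearMap.mulLeft R b) (by
      rw [Ideal.span_le, Set.singleton_subset_iff]
      exact Ideal.mem_span_singleton.2 (dvd_of_eq (mul_comm a b)))
  have hμ : ∀ r, μ (Ideal.Quotient.mk _ r) = Ideal.Quotient.mk _ (b * r) := fun r => rfl
  obtain ⟨c, hc⟩ := exists_forall_eq_mk_mul hR (mul_mem ha hb) U (haI b hbI) (μ ∘ₗ h)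
    (by rw [LinearMap.comp_apply, h0 b hbI, map_zero])
  have hdvd : ∀ x ∈ I, b ∣ c * x := by
    intro x hx
    have h1 := hc ⟨a * x, haI x hx⟩
    rw [LinearMap.comp_apply, h0 x hx, map_zero, eq_comm, Ideal.Quotient.eq_zero_iff_dvd] at h1
    obtain ⟨t, ht⟩ := h1
    refine ⟨t, (mul_cancel_left_mem_nonZeroDivisors ha).1 ?_⟩
    linear_combination ht
  obtain ⟨g, hg⟩ := LinearMap.exists_mul_apply_eq hb (LinearMap.mulLeft R c ∘ₗ I.subtype)
    (fun x => hdvd x x.2)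
  refine ⟨g, fun x => ?_⟩
  obtain ⟨t, ht⟩ := Ideal.Quotient.mk_surjective (h x)
  have h1 := hc x
  rw [LinearMap.comp_apply, ← ht, hμ, Ideal.Quotient.eq, Ideal.mem_span_singleton] at h1
  have h2 : c * (x : R) = b * g ⟨x, hUI x.2⟩ := hg ⟨x, hUI x.2⟩
  rw [← ht, eq_comm, Ideal.Quotient.eq, Ideal.mem_span_singleton]
  obtain ⟨s, hs⟩ := h1
  refine ⟨s, (mul_cancel_left_mem_nonZeroDivisors hb).1 ?_⟩
  rw [h2] at hs
  linear_combination hs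

theorem mem_of_forall_dvd_mul
    (hR : IsGorensteinDual R)
    {b : R} (hb : b ∈ nonZeroDivisors R) {I : Ideal R} (hbI : b ∈ I) {x₀ : R}
    (hx₀ : ∀ c, (∀ i ∈ I, b ∣ c * i) → b ∣ c * x₀) : x₀ ∈ I := by
  by_contra hx
  have hbI' : Ideal.span {b} ≤ I := (Ideal.span_singleton_le_iff_mem _).2 hbI
  obtain ⟨n, hn⟩ := hR.pow_le hb
  obtain ⟨w, hw, hmw⟩ := exists_notMem_and_forall_mul_mem (𝔞 := Ideal.span {b})
    (fun h => hx ((h ▸ hbI' : ⊤ ≤ I) trivial)) hn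
  let π : I × R →ₗ[R] ↥(I ⊔ Ideal.span {x₀}) :=
    LinearMap.codRestrict _ (LinearMap.coprod I.subtype (LinearMap.mulRight R x₀)) (fun p =>
      Submodule.add_mem_sup p.1.2 (Ideal.mul_mem_left _ _ (Ideal.mem_span_singleton_self x₀)))
  have hπv : ∀ p, (π p : R) = p.1 + p.2 * x₀ := fun p => rfl
  have hπ : Function.Surjective π := by
    rintro ⟨x, hx⟩
    obtain ⟨y, hy, z, hz, rfl⟩ := Submodule.mem_sup.1 hx
    obtain ⟨r, rfl⟩ := Ideal.mem_span_singleton'.1 hz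
    exact ⟨(⟨y, hy⟩, r), rfl⟩
  obtain ⟨h, hh⟩ := LinearMap.exists_apply_eq_of_ker_le hπ
    (LinearMap.toSpanSingleton R (R ⧸ Ideal.span {b}) (Ideal.Quotient.mk _ w) ∘ₗ
      LinearMap.snd R I R)
    (by
      rintro ⟨z, r⟩ hzr
      have h1 : (z : R) + r * x₀ = 0 := congrArg Subtype.val hzr
      have hr : r ∈ maximalIdeal R := by
        by_contra hr
        obtain ⟨u, rfl⟩ := notMem_maximalIdeal.1 hr
        refine hx ?_
        have : x₀ = -(↑u⁻¹ * (z : R)) := by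
          rw [eq_neg_of_add_eq_zero_left h1]; simp
        rw [this]
        exact I.neg_mem (I.mul_mem_left _ z.2)
      exact Ideal.Quotient.eq_zero_iff_mem.2 (hmw r hr))
  have hI : ∀ i (hi : i ∈ I), h ⟨i, Ideal.mem_sup_left hi⟩ = 0 := by
    intro i hi
    have := hh (⟨i, hi⟩, 0)
    rw [LinearMap.comp_apply, LinearMap.snd_apply, map_zero] at this
    rw [← this]
    congr 1
    exact Subtype.ext (by simp [hπv])
  obtain ⟨c, hc⟩ := exists_forall_eq_mk_mul hR hb _ (Ideal.mem_sup_left hbI) h (hI b hbI)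
  have h1 : b ∣ c * x₀ := hx₀ c fun i hi => by
    rw [← Ideal.Quotient.eq_zero_iff_dvd]
    exact (hc ⟨i, Ideal.mem_sup_left hi⟩).symm.trans (hI i hi)
  have h2 := hc (π (0, 1))
  rw [hh, LinearMap.comp_apply, LinearMap.snd_apply, LinearMap.toSpanSingleton_apply, one_smul,
    show ((π (0, 1) : ↥(I ⊔ Ideal.span {x₀})) : R) = x₀ by simp [hπv],
    Ideal.Quotient.eq_zero_iff_dvd _ _ |>.2 h1, Ideal.Quotient.eq_zero_iff_mem] at h2
  exact hw h2

/-- Ideals containing a nonzerodivisor are reflexive. -/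
theorem exists_forall_eq_apply
    (hR : IsGorensteinDual R)
    {b : R} (hb : b ∈ nonZeroDivisors R) {I : Ideal R} (hbI : b ∈ I)
    (φ : (I →ₗ[R] R) →ₗ[R] R) : ∃ x : I, ∀ f, φ f = f x := by
  have key : ∀ f : I →ₗ[R] R, b * φ f = f ⟨b, hbI⟩ * φ I.subtype := by
    intro f
    have : b • f = f ⟨b, hbI⟩ • I.subtype := by
      ext x
      simpa [mul_comm] using mul_apply_eq_mul_apply f ⟨b, hbI⟩ x
    simpa using congrArg φ this
  have hx : φ I.subtype ∈ I := by
    refine mem_of_forall_dvd_mul hR hb hbI fun c hc => ?_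
    obtain ⟨g, hg⟩ := LinearMap.exists_mul_apply_eq hb (LinearMap.mulLeft R c ∘ₗ I.subtype)
      (fun x => hc x x.2)
    have h1 : c * b = b * g ⟨b, hbI⟩ := hg ⟨b, hbI⟩
    have h2 : c = g ⟨b, hbI⟩ :=
      (mul_cancel_left_mem_nonZeroDivisors hb).1 (by rw [← h1, mul_comm])
    exact ⟨φ g, by rw [key, ← h2]⟩
  refine ⟨⟨_, hx⟩, fun f => (mul_cancel_left_mem_nonZeroDivisors hb).1 ?_⟩
  rw [key]
  simpa [mul_comm] using (mul_apply_eq_mul_apply f ⟨b, hbI⟩ ⟨_, hx⟩).symm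

end Duality

theorem evalMap_injective_of_torsion_eq_bot {R : Type*} [CommRing R] {I : Ideal R} {b : R}
    (hb : b ∈ nonZeroDivisors R) (hbI : b ∈ I)
    (htf : Submodule.torsion R (I ⊗[R] (I →ₗ[R] R)) = ⊥) :
    Function.Injective (evalMap R I R) := by
  have key : ∀ t : I ⊗[R] (I →ₗ[R] R),
      (b * b) • t = (b * evalMap R I R t) • ((⟨b, hbI⟩ : I) ⊗ₜ[R] I.subtype) := by
    intro t
    induction t with
    | zero => simp
    | add x y hx hy => rw [smul_add, map_add, mul_add, add_smul, hx, hy]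
    | tmul x f =>
      have h1 : b • f = f ⟨b, hbI⟩ • I.subtype := by
        ext x
        simpa [mul_comm] using mul_apply_eq_mul_apply f ⟨b, hbI⟩ x
      have h2 : b • x = (x : R) • (⟨b, hbI⟩ : I) := Subtype.ext (mul_comm _ _)
      have h3 : evalMap R I R (x ⊗ₜ f) = f x := rfl
      rw [mul_smul, ← TensorProduct.tmul_smul, h1, TensorProduct.smul_tmul', h2, h3,
        TensorProduct.tmul_smul, ← TensorProduct.smul_tmul', smul_smul, mul_comm,
        mul_apply_eq_mul_apply f x ⟨b, hbI⟩]
  rw [injective_iff_map_eq_zero]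
  intro t ht
  have h1 : t ∈ Submodule.torsion R (I ⊗[R] (I →ₗ[R] R)) :=
    (Submodule.mem_torsion_iff _).2 ⟨⟨b * b, mul_mem hb hb⟩, by
      rw [Submonoid.mk_smul, key, ht, mul_zero, zero_smul]⟩
  rwa [htf, Submodule.mem_bot] at h1

/-- Every homomorphism `M → M/aM` lifts to an endomorphism of `M`. -/
def EndLifts (R M : Type*) [CommRing R] [AddCommGroup M] [Module R M] (a : R) : Prop :=
  ∀ h : M →ₗ[R] M ⧸ (a • (⊤ : Submodule R M)),
    ∃ H : M →ₗ[R] M, ∀ x, Submodule.Quotient.mk (H x) = h x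

theorem mem_smul_top_iff {R M : Type*} [CommRing R] [AddCommGroup M] [Module R M] {a : R} {x : M} :
    x ∈ a • (⊤ : Submodule R M) ↔ ∃ y, a • y = x := by
  simp [Submodule.mem_smul_pointwise_iff_exists]

/-- If `I ⊗ Hom(I, R)` embeds in `R` via evaluation, all homomorphisms `I → I/aI` lift. -/
theorem IsGorensteinDual.endLifts {R : Type*} [CommRing R] [IsLocalRing R] [IsNoetherianRing R]
    (hR : IsGorensteinDual R) {a b : R} (ha : a ∈ nonZeroDivisors R)
    (hb : b ∈ nonZeroDivisors R) {I : Ideal R} (hbI : b ∈ I)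
    (hinj : Function.Injective (evalMap R I R)) : EndLifts R I a := by
  intro h
  let bar : (I →ₗ[R] R) →ₗ[R] (I ⧸ (a • (⊤ : Submodule R I))) →ₗ[R] R ⧸ Ideal.span {a} :=
    { toFun := fun f => Submodule.mapQ _ _ f (by
        intro x hx
        obtain ⟨y, rfl⟩ := mem_smul_top_iff.1 hx
        exact Ideal.mem_span_singleton.2 ⟨f y, by simp⟩)
      map_add' := fun f g => by
        ext x
        rfl
      map_smul' := fun c f => by
        ext x
        rfl }
  have hbar : ∀ f x, bar f (Submodule.Quotient.mk x) = Ideal.Quotient.mk _ (f x) := fun f x => rfl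
  let g : I ⊗[R] (I →ₗ[R] R) →ₗ[R] R ⧸ Ideal.span {a} :=
    TensorProduct.lift (bar.flip ∘ₗ h)
  let L : Ideal R := LinearMap.range (evalMap R I R)
  obtain ⟨g', hg'⟩ := LinearMap.exists_apply_eq_of_ker_le
    (π := (evalMap R I R).rangeRestrict) (LinearMap.surjective_rangeRestrict _) g (fun x hx => by
      have : x = 0 := hinj (by simpa using congrArg Subtype.val hx)
      rw [this, map_zero])
  have hbL : b ∈ L := ⟨(⟨b, hbI⟩ : I) ⊗ₜ I.subtype, rfl⟩
  obtain ⟨G, hG⟩ := exists_lift_extend hR ha hb hbL le_rfl (fun x hx => L.mul_mem_left _ hx) g'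
    (fun x hx => by
      have : (⟨a * x, L.mul_mem_left _ hx⟩ : L) = a • ⟨x, hx⟩ := rfl
      rw [this, map_smul]
      obtain ⟨y, hy⟩ := Ideal.Quotient.mk_surjective (g' ⟨x, hx⟩)
      rw [← hy]
      exact Ideal.Quotient.eq_zero_iff_mem.2 (Ideal.mul_mem_right _ _
        (Ideal.mem_span_singleton_self a)))
  let ev : I →ₗ[R] (I →ₗ[R] R) →ₗ[R] L := TensorProduct.curry (evalMap R I R).rangeRestrict
  have hev : ∀ (x : I) (f : I →ₗ[R] R), Ideal.Quotient.mk _ (G (ev x f)) = bar f (h x) := by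
    intro x f
    exact (hG (ev x f)).trans (hg' (x ⊗ₜ f))
  have hy : ∀ x : I, ∃ y : I, ∀ f : I →ₗ[R] R, G (ev x f) = f y := fun x =>
    exists_forall_eq_apply hR hb hbI (G ∘ₗ ev x)
  choose y hy using hy
  have ext' : ∀ {u v : I}, (∀ f : I →ₗ[R] R, f u = f v) → u = v :=
    fun h => Subtype.ext (h I.subtype)
  refine ⟨{ toFun := y, map_add' := fun u v => ext' fun f => ?_,
            map_smul' := fun c u => ext' fun f => ?_ }, fun x => ?_⟩
  · rw [map_add, ← hy, ← hy, ← hy, map_add, LinearMap.add_apply, map_add]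
  · rw [map_smul, ← hy, ← hy, map_smul, LinearMap.smul_apply, map_smul, RingHom.id_apply]
  · obtain ⟨z, hz⟩ := Submodule.Quotient.mk_surjective _ (h x)
    have h1 : ∀ f : I →ₗ[R] R, a ∣ f (y x - z) := by
      intro f
      have := hev x f
      rw [← hz, hbar, hy, Ideal.Quotient.eq, Ideal.mem_span_singleton] at this
      rwa [map_sub]
    obtain ⟨φ, hφ⟩ := LinearMap.exists_mul_apply_eq ha (LinearMap.applyₗ (y x - z)) h1
    obtain ⟨w, hw⟩ := exists_forall_eq_apply hR hb hbI φ
    rw [← hz]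
    refine (Submodule.Quotient.eq _).2 (mem_smul_top_iff.2 ⟨w, Subtype.ext ?_⟩)
    have h2 := hφ I.subtype
    rw [hw] at h2
    exact h2.symm

/-- The socle of a module over a local ring. -/
def socle (R M : Type*) [CommRing R] [IsLocalRing R] [AddCommGroup M] [Module R M] :
    Submodule R M where
  carrier := {x | ∀ c ∈ maximalIdeal R, c • x = 0}
  add_mem' hx hy c hc := by rw [smul_add, hx c hc, hy c hc, add_zero]
  zero_mem' c _ := smul_zero c
  smul_mem' r x hx c hc := by rw [smul_comm, hx c hc, smul_zero]

theorem mem_socle {R M : Type*} [CommRing R] [IsLocalRing R] [AddCommGroup M] [Module R M]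
    {x : M} : x ∈ socle R M ↔ ∀ c ∈ maximalIdeal R, c • x = 0 := Iff.rfl

theorem surjective_of_injective_of_length_eq {R E F : Type*} [CommRing R] [AddCommGroup E]
    [Module R E] [AddCommGroup F] [Module R F] {j : E →ₗ[R] F} (hj : Function.Injective j)
    (hlen : Module.length R E = Module.length R F) (hfin : Module.length R F ≠ ⊤) :
    Function.Surjective j := by
  have h := Module.length_eq_add_of_exact j (LinearMap.range j).mkQ hj
    (Submodule.mkQ_surjective _) (LinearMap.exact_map_mkQ_range j)
  rw [hlen] at h
  have h1 : Module.length R (F ⧸ LinearMap.range j) = 0 :=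
    (WithTop.add_left_inj hfin).1 ((add_zero _).trans h).symm
  rw [Module.length_eq_zero_iff, Submodule.Quotient.subsingleton_iff] at h1
  exact LinearMap.range_eq_top.1 h1

theorem length_quotient_map_eq_add {R E F : Type*} [CommRing R] [AddCommGroup E] [Module R E]
    [AddCommGroup F] [Module R F] {j : E →ₗ[R] F} (hj : Function.Injective j)
    (A : Submodule R E) :
    Module.length R (F ⧸ A.map j) =
      Module.length R (E ⧸ A) + Module.length R (F ⧸ LinearMap.range j) := by
  refine Module.length_eq_add_of_exact (Submodule.mapQ A (A.map j) j (Submodule.le_comap_map _ _))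
    (Submodule.factor (LinearMap.map_le_range)) ?_ (Submodule.factor_surjective _) ?_
  · rw [← LinearMap.ker_eq_bot, Submodule.ker_mapQ, Submodule.comap_map_eq_of_injective hj]
    exact Submodule.mkQ_map_self A
  · intro x
    obtain ⟨x, rfl⟩ := Submodule.Quotient.mk_surjective _ x
    constructor
    · intro hx
      obtain ⟨y, rfl⟩ := (Submodule.Quotient.mk_eq_zero _).1 hx
      exact ⟨Submodule.Quotient.mk y, rfl⟩
    · rintro ⟨y, hy⟩
      obtain ⟨y, rfl⟩ := Submodule.Quotient.mk_surjective _ y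
      rw [← hy]
      exact (Submodule.Quotient.mk_eq_zero _).2 ⟨y, rfl⟩

/-- Submodules of finite colength have the same length modulo a nonzerodivisor. -/
theorem length_quotient_smul_top_eq {R E F : Type*} [CommRing R] [AddCommGroup E] [Module R E]
    [AddCommGroup F] [Module R F] {j : E →ₗ[R] F} (hj : Function.Injective j)
    (hfin : Module.length R (F ⧸ LinearMap.range j) ≠ ⊤) {a : R}
    (ha : ∀ x : F, a • x = 0 → x = 0) :
    Module.length R (E ⧸ (a • (⊤ : Submodule R E))) =
      Module.length R (F ⧸ (a • (⊤ : Submodule R F))) := by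
  have h1 := length_quotient_map_eq_add hj (a • (⊤ : Submodule R E))
  have hμ : Function.Injective (LinearMap.lsmul R F a) := (injective_iff_map_eq_zero _).2 ha
  have h2 := length_quotient_map_eq_add hμ (LinearMap.range j)
  have e1 : (a • (⊤ : Submodule R E)).map j = (LinearMap.range j).map (LinearMap.lsmul R F a) := by
    ext x
    simp only [Submodule.mem_map, mem_smul_top_iff, LinearMap.mem_range, LinearMap.lsmul_apply]
    exact ⟨by rintro ⟨_, ⟨y, rfl⟩, rfl⟩; exact ⟨_, ⟨y, rfl⟩, by simp⟩,
      by rintro ⟨_, ⟨y, rfl⟩, rfl⟩; exact ⟨_, ⟨y, rfl⟩, by simp⟩⟩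
  have e2 : LinearMap.range (LinearMap.lsmul R F a) = a • (⊤ : Submodule R F) := by
    ext x
    simp [mem_smul_top_iff]
  rw [← e1, e2, h1, add_comm] at h2
  exact (WithTop.add_left_inj hfin).1 h2

/-- If `I/aI` has a socle of length at most one, then `I` is principal. -/
theorem IsGorensteinDual.exists_eq_span_singleton {R : Type*} [CommRing R] [IsLocalRing R]
    [IsNoetherianRing R] (hR : IsGorensteinDual R) {a b : R} (ha : a ∈ nonZeroDivisors R)
    (ham : a ∈ maximalIdeal R) (hb : b ∈ nonZeroDivisors R) {I : Ideal R} (hbI : b ∈ I)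
    (hfin : Module.length R (R ⧸ I) ≠ ⊤) (hafin : Module.length R (R ⧸ Ideal.span {a}) ≠ ⊤)
    (hsoc : Module.length R (socle R (I ⧸ (a • (⊤ : Submodule R I)))) ≤ 1) :
    ∃ x, I = Ideal.span {x} := by
  let M := I ⧸ (a • (⊤ : Submodule R I))
  have hlen : Module.length R M = Module.length R (R ⧸ Ideal.span {a}) := by
    have e2 : a • (⊤ : Submodule R R) = Ideal.span {a} := by
      ext x
      rw [mem_smul_top_iff, Ideal.mem_span_singleton]
      exact ⟨fun ⟨y, hy⟩ => ⟨y, hy.symm⟩, fun ⟨y, hy⟩ => ⟨y, hy.symm⟩⟩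
    have := length_quotient_smul_top_eq (R := R) (E := I) (F := R) (j := I.subtype)
      Subtype.val_injective (by rwa [Submodule.range_subtype]) (a := a)
      (fun x hx => (mul_left_mem_nonZeroDivisors_eq_zero_iff ha).1 hx)
    rwa [e2] at this
  have hne : Ideal.span {a} ≠ ⊤ := fun h => by
    rw [Ideal.span_singleton_eq_top] at h
    exact (mem_maximalIdeal a).1 ham h
  obtain ⟨n, hn⟩ := hR.pow_le ha
  obtain ⟨w, hw, hmw⟩ := exists_notMem_and_forall_mul_mem hne hn
  have hnM : ∀ x : M, ∀ c ∈ maximalIdeal R ^ n, c • x = 0 := by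
    intro x c hc
    obtain ⟨x, rfl⟩ := Submodule.Quotient.mk_surjective _ x
    obtain ⟨d, rfl⟩ := Ideal.mem_span_singleton.1 (hn hc)
    rw [← Submodule.Quotient.mk_smul, Submodule.Quotient.mk_eq_zero, mem_smul_top_iff]
    exact ⟨d • x, (mul_smul _ _ _).symm⟩
  have hM0 : Nontrivial M := by
    rw [← Module.length_pos_iff (R := R), hlen, Module.length_pos_iff]
    exact Ideal.Quotient.nontrivial_iff.2 hne
  obtain ⟨x₀, hx₀⟩ := exists_ne (0 : M)
  obtain ⟨r₀, hr₀, hsr₀⟩ := exists_smul_ne_zero_and_forall_smul_eq_zero hx₀ (hnM x₀)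
  let t : socle R M := ⟨r₀ • x₀, hsr₀⟩
  have ht : t ≠ 0 := fun h => hr₀ (congrArg Subtype.val h)
  have hspan : ∀ x : socle R M, ∃ r : R, r • t = x := by
    have : Nontrivial (socle R M) := ⟨t, 0, ht⟩
    have : IsSimpleModule R (socle R M) := Module.length_eq_one_iff.1
      (le_antisymm hsoc (Order.one_le_iff_pos.2 Module.length_pos))
    exact IsSimpleModule.toSpanSingleton_surjective R ht
  have hker : ∀ r : R, r • t = 0 → r ∈ maximalIdeal R := by
    intro r hr
    by_contra h
    obtain ⟨u, rfl⟩ := notMem_maximalIdeal.1 h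
    exact ht ((smul_eq_zero_iff_eq u).1 hr)
  obtain ⟨h₀, hh₀⟩ := LinearMap.exists_apply_eq_of_ker_le (π := LinearMap.toSpanSingleton R _ t)
    hspan (LinearMap.toSpanSingleton R (R ⧸ Ideal.span {a}) (Ideal.Quotient.mk _ w))
    (fun r hr => Ideal.Quotient.eq_zero_iff_mem.2 (hmw r (hker r hr)))
  let U : Ideal R := ((socle R M).comap (Submodule.mkQ _)).map I.subtype
  have hUI : U ≤ I := Submodule.map_subtype_le _ _
  have hU : ∀ x : U, Submodule.Quotient.mk ⟨x, hUI x.2⟩ ∈ socle R M := by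
    rintro ⟨_, x, hx, rfl⟩
    exact hx
  have haI : ∀ x ∈ I, a * x ∈ U := fun x hx => by
    refine ⟨a • ⟨x, hx⟩, ?_, rfl⟩
    have : Submodule.mkQ (a • (⊤ : Submodule R I)) (a • ⟨x, hx⟩) = 0 :=
      (Submodule.Quotient.mk_eq_zero _).2 (mem_smul_top_iff.2 ⟨_, rfl⟩)
    change Submodule.mkQ (a • (⊤ : Submodule R I)) (a • ⟨x, hx⟩) ∈ socle R M
    rw [this]
    exact zero_mem _
  let q : U →ₗ[R] socle R M :=
    LinearMap.codRestrict _ (Submodule.mkQ _ ∘ₗ Submodule.inclusion hUI) hU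
  obtain ⟨g, hg⟩ := exists_lift_extend hR ha hb hbI hUI haI (h₀ ∘ₗ q) (fun x hx => by
    have : q ⟨a * x, haI x hx⟩ = 0 := Subtype.ext
      ((Submodule.Quotient.mk_eq_zero _).2 (mem_smul_top_iff.2 ⟨⟨x, hx⟩, rfl⟩))
    rw [LinearMap.comp_apply, this, map_zero])
  let g' : M →ₗ[R] R ⧸ Ideal.span {a} := Submodule.mapQ _ _ g (by
    intro x hx
    obtain ⟨y, rfl⟩ := mem_smul_top_iff.1 hx
    exact Ideal.mem_span_singleton.2 ⟨g y, by simp⟩)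
  have hg's : ∀ x (hx : x ∈ socle R M), g' x = h₀ ⟨x, hx⟩ := by
    intro x hx
    obtain ⟨x, rfl⟩ := Submodule.Quotient.mk_surjective _ x
    exact hg ⟨x, x, hx, rfl⟩
  have hg'inj : Function.Injective g' := by
    rw [injective_iff_map_eq_zero]
    intro x hx
    by_contra hx0
    obtain ⟨r, hr, hrs⟩ := exists_smul_ne_zero_and_forall_smul_eq_zero hx0 (hnM x)
    obtain ⟨s, hs⟩ := hspan ⟨r • x, hrs⟩
    have h1 : g' (r • x) = 0 := by rw [map_smul, hx, smul_zero]
    rw [hg's _ hrs, ← hs] at h1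
    have h2 : Ideal.Quotient.mk (Ideal.span {a}) (s * w) = 0 := (hh₀ s).symm.trans h1
    by_cases hsm : s ∈ maximalIdeal R
    · apply hr
      have : s • t = 0 := Subtype.ext (t.2 s hsm)
      rw [this] at hs
      exact (congrArg Subtype.val hs).symm
    · obtain ⟨u, rfl⟩ := notMem_maximalIdeal.1 hsm
      rw [Ideal.Quotient.eq_zero_iff_mem] at h2
      exact hw ((Ideal.unit_mul_mem_iff_mem _ u.isUnit).1 h2)
  have hg'surj : Function.Surjective g' :=
    surjective_of_injective_of_length_eq hg'inj hlen hafin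
  obtain ⟨x, hx⟩ := hg'surj (Ideal.Quotient.mk _ 1)
  obtain ⟨x, rfl⟩ := Submodule.Quotient.mk_surjective _ x
  have hgx : Ideal.Quotient.mk (Ideal.span {a}) (g x) = Ideal.Quotient.mk _ 1 := hx
  have hunit : IsUnit (g x) := by
    rw [← notMem_maximalIdeal]
    intro h
    rw [Ideal.Quotient.eq] at hgx
    have h1 := (maximalIdeal R).sub_mem h ((Ideal.span_singleton_le_iff_mem _).2 ham hgx)
    rw [sub_sub_cancel] at h1
    exact (Ideal.ne_top_iff_one _).1 Ideal.IsPrime.ne_top' h1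
  obtain ⟨v, hv⟩ := hunit
  refine ⟨x, le_antisymm (fun i hi => ?_) ((Ideal.span_singleton_le_iff_mem _).2 x.2)⟩
  have h1 := mul_apply_eq_mul_apply g ⟨i, hi⟩ x
  rw [← hv] at h1
  refine Ideal.mem_span_singleton.2 ⟨g ⟨i, hi⟩ * ↑v⁻¹, ?_⟩
  rw [← mul_assoc, ← h1, Units.mul_inv_cancel_right]

/-- A minimal system of generators of a finite module over a local ring, together with the
dual coordinates with values in the residue field. -/
theorem exists_generators_and_coordinates {S M : Type*} [CommRing S] [IsLocalRing S]
    [AddCommGroup M] [Module S M] [Module.Finite S M] :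
    ∃ (r : ℕ) (x : Fin r → M) (π : Fin r → M →ₗ[S] S ⧸ maximalIdeal S),
      Submodule.span S (Set.range x) = ⊤ ∧
      (∀ i j, π i (x j) = if i = j then 1 else 0) ∧
      Module.length S (M ⧸ (maximalIdeal S • (⊤ : Submodule S M))) = r := by
  let _ := Ideal.Quotient.field (maximalIdeal S)
  let N := M ⧸ (maximalIdeal S • (⊤ : Submodule S M))
  have : Module.Finite (S ⧸ maximalIdeal S) N := Module.Finite.of_restrictScalars_finite S _ _
  let b := Module.finBasis (S ⧸ maximalIdeal S) N
  choose x hx using fun i => Submodule.Quotient.mk_surjective _ (b i)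
  refine ⟨_, x, fun i => ((b.coord i).restrictScalars S) ∘ₗ Submodule.mkQ _, ?_, ?_, ?_⟩
  · refine top_le_iff.1 (Submodule.le_of_le_smul_of_le_jacobson_bot Module.Finite.fg_top
      (maximalIdeal_le_jacobson ⊥) fun z _ => ?_)
    choose c hc using fun i => Ideal.Quotient.mk_surjective (b.repr (Submodule.Quotient.mk z) i)
    have h1 : (Submodule.Quotient.mk z : N) = Submodule.mkQ _ (∑ i, c i • x i) := by
      rw [map_sum, ← b.sum_repr (Submodule.Quotient.mk z)]
      refine Finset.sum_congr rfl fun i _ => ?_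
      rw [← hc, map_smul, Submodule.mkQ_apply, hx]
      rfl
    rw [← add_sub_cancel (∑ i, c i • x i) z]
    exact Submodule.add_mem_sup
      (Submodule.sum_mem _ fun i _ => Submodule.smul_mem _ _ (Submodule.subset_span ⟨i, rfl⟩))
      ((Submodule.Quotient.eq _).1 h1)
  · intro i j
    change b.coord i (Submodule.Quotient.mk (x j)) = _
    rw [hx, Module.Basis.coord_apply, Module.Basis.repr_self, Finsupp.single_apply]
    simp only [eq_comm]
  · rw [← Module.length_eq_finrank]
    exact Module.length_eq_of_surjective Ideal.Quotient.mk_surjective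

theorem not_length_end_le {S M : Type*} [CommRing S] [IsLocalRing S]
    [AddCommGroup M] [Module S M] [Module.Finite S M] {e : ℕ} (he : e ≤ 6)
    (hM : Module.length S M = e) (hend : Module.length S (Module.End S M) ≤ e)
    (hr : 2 ≤ Module.length S (M ⧸ (maximalIdeal S • (⊤ : Submodule S M))))
    (hs : 2 ≤ Module.length S (socle S M)) : False := by
  obtain ⟨r, x, π, hspan, hπ, hlr⟩ := exists_generators_and_coordinates (S := S) (M := M)
  have hgen : ∀ z : M, ∃ c : Fin r → S, ∑ i, c i • x i = z := fun z =>
    (Submodule.mem_span_range_iff_exists_fun S).1 (hspan ▸ Submodule.mem_top)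
  let ρ : socle S (Module.End S M) →ₗ[S] Fin r → socle S M :=
    LinearMap.pi fun i => LinearMap.codRestrict _
      (LinearMap.applyₗ (x i) ∘ₗ (socle S (Module.End S M)).subtype)
      (fun f c hc => LinearMap.congr_fun (f.2 c hc) (x i))
  have hρ : Function.Surjective ρ := by
    intro t
    let τ : ∀ i, (S ⧸ maximalIdeal S) →ₗ[S] M := fun i =>
      Submodule.liftQ (maximalIdeal S) (LinearMap.toSpanSingleton S M (t i))
        (fun c hc => (t i).2 c hc)
    have hτ1 : ∀ i, τ i 1 = t i := fun i => one_smul S _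
    have hτ : ∀ i, ∀ c ∈ maximalIdeal S, c • τ i = 0 := by
      intro i c hc
      ext
      exact mem_socle.1 (Submodule.smul_mem _ _ (t i).2) c hc
    refine ⟨⟨∑ i, τ i ∘ₗ π i, fun c hc => ?_⟩, ?_⟩
    · rw [Finset.smul_sum]
      refine Finset.sum_eq_zero fun i _ => ?_
      rw [← LinearMap.smul_comp, hτ i c hc, LinearMap.zero_comp]
    · funext j
      refine Subtype.ext ?_
      change (∑ i, τ i ∘ₗ π i) (x j) = t j
      rw [LinearMap.sum_apply, Finset.sum_eq_single j]
      · rw [LinearMap.comp_apply, hπ, if_pos rfl, hτ1]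
      · intro i _ hij
        rw [LinearMap.comp_apply, hπ, if_neg hij, map_zero]
      · simp
  let Φ : (Fin r → Module.End S M) →ₗ[S] M ⧸ socle S M :=
    Submodule.mkQ _ ∘ₗ ∑ i, LinearMap.applyₗ (x i) ∘ₗ LinearMap.proj i
  have hΦ : ∀ f, Φ f = Submodule.Quotient.mk (∑ i, f i (x i)) := by
    intro f
    change Submodule.mkQ _ ((∑ i, LinearMap.applyₗ (x i) ∘ₗ LinearMap.proj i :
      (Fin r → Module.End S M) →ₗ[S] M) f) = _
    rw [LinearMap.sum_apply]
    rfl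
  have hΦs : Function.Surjective Φ := by
    intro z
    obtain ⟨z, rfl⟩ := Submodule.Quotient.mk_surjective _ z
    obtain ⟨c, rfl⟩ := hgen z
    exact ⟨fun i => c i • LinearMap.id, by rw [hΦ]; simp⟩
  let j : (Fin r → socle S (Module.End S M)) →ₗ[S] LinearMap.ker Φ :=
    LinearMap.codRestrict _ (LinearMap.pi fun i => Submodule.subtype _ ∘ₗ LinearMap.proj i) (by
      intro f
      rw [LinearMap.mem_ker, hΦ, Submodule.Quotient.mk_eq_zero]
      exact Submodule.sum_mem _ fun i _ => fun c hc => LinearMap.congr_fun ((f i).2 c hc) (x i))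
  have hj : Function.Injective j := by
    intro f g h
    funext i
    exact Subtype.ext (congrFun (congrArg Subtype.val h) i)
  have l1 := Module.length_le_of_surjective ρ hρ
  have l2 := Module.length_le_of_injective j hj
  have l3 := Module.length_eq_add_of_exact (LinearMap.ker Φ).subtype Φ
    Subtype.val_injective hΦs (LinearMap.exact_subtype_ker_map Φ)
  have l4 := Module.length_eq_add_of_exact (socle S M).subtype (socle S M).mkQ
    Subtype.val_injective (Submodule.mkQ_surjective _) (LinearMap.exact_subtype_mkQ _)
  simp only [Module.length_pi_of_fintype, Finset.sum_const, Finset.card_univ, Fintype.card_fin,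
    nsmul_eq_mul] at l1 l2 l3
  have hjs : r = 2 ∧ e = 6 ∧ Module.length S (M ⧸ socle S M) = 4 ∧ Function.Surjective j := by
    have hend' : Module.length S (Module.End S M) ≠ ⊤ :=
      ne_top_of_le_ne_top (ENat.natCast_ne_top e) hend
    have hsoc' := ne_top_of_le_ne_top hend'
      (Module.length_le_of_injective (socle S (Module.End S M)).subtype Subtype.val_injective)
    have hM' : Module.length S M ≠ ⊤ := hM ▸ ENat.natCast_ne_top e
    have hT' := ne_top_of_le_ne_top hM'
      (Module.length_le_of_injective (socle S M).subtype Subtype.val_injective)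
    have hQ' := ne_top_of_le_ne_top hM'
      (Module.length_le_of_surjective (socle S M).mkQ (Submodule.mkQ_surjective _))
    have hk' : Module.length S (LinearMap.ker Φ) ≠ ⊤ := by
      have h : (r : ℕ∞) * Module.length S (Module.End S M) ≠ ⊤ :=
        WithTop.mul_ne_top (ENat.natCast_ne_top r) hend'
      exact ne_top_of_le_ne_top h (l3 ▸ le_self_add)
    rw [hM] at l4
    have hinj := surjective_of_injective_of_length_eq hj
    simp only [Module.length_pi_of_fintype, Finset.sum_const, Finset.card_univ, Fintype.card_fin,
      nsmul_eq_mul] at hinj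
    replace hinj := fun h => hinj h hk'
    rw [hlr] at hr
    generalize Module.length S (Module.End S M) = Λ at *
    generalize Module.length S (socle S (Module.End S M)) = Λ₀ at *
    generalize Module.length S (socle S M) = s at *
    generalize Module.length S (M ⧸ socle S M) = q at *
    generalize Module.length S (LinearMap.ker Φ) = k at *
    lift Λ to ℕ using hend'
    lift Λ₀ to ℕ using hsoc'
    lift s to ℕ using hT'
    lift q to ℕ using hQ'
    lift k to ℕ using hk'
    norm_cast at *
    have h1 : r * s ≤ q := by
      have : (r - 1) * (r * s) ≤ (r - 1) * q := by
        obtain ⟨r, rfl⟩ : ∃ r', r = r' + 1 := ⟨r - 1, by lia⟩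
        simp only [Nat.add_sub_cancel]
        nlinarith
      exact Nat.le_of_mul_le_mul_left this (by lia)
    have h2 : r = 2 := by nlinarith
    subst h2
    refine ⟨rfl, by lia, by lia, hinj (by lia)⟩
  obtain ⟨rfl, rfl, h4, hjs⟩ := hjs
  have key : ∀ f : Fin 2 → Module.End S M, ∑ i, f i (x i) = 0 →
      ∀ i, ∀ c ∈ maximalIdeal S, c • f i = 0 := by
    intro f hf i
    obtain ⟨g, hg⟩ := hjs ⟨f, by rw [LinearMap.mem_ker, hΦ, hf]; rfl⟩
    have : g i = f i := congrFun (congrArg Subtype.val hg) i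
    rw [← this]
    exact (g i).2
  by_cases hsq : ∀ p ∈ maximalIdeal S, ∀ q ∈ maximalIdeal S, ∀ z : M, p • q • z = 0
  · have hle : maximalIdeal S • (⊤ : Submodule S M) ≤ socle S M :=
      Submodule.smul_le.2 fun q hq z _ p hp => hsq p hp q hq z
    have := Module.length_le_of_surjective _ (Submodule.factor_surjective hle)
    rw [h4, hlr] at this
    exact absurd this (by decide)
  · push Not at hsq
    obtain ⟨p, hp, q, hq, z, hz⟩ := hsq
    obtain ⟨φ, hφ⟩ := LinearMap.exists_apply_eq_of_ker_le (π := Fintype.linearCombination S x)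
      (fun z => by simpa [Fintype.linearCombination_apply] using hgen z)
      (LinearMap.toSpanSingleton S M (q • x 1) ∘ₗ LinearMap.proj 0) (fun c hc => by
        have := key (fun i => c i • LinearMap.id)
          (by simpa [Fintype.linearCombination_apply] using hc) 0 q hq
        have := LinearMap.congr_fun this (x 1)
        change c 0 • q • x 1 = 0
        rw [smul_comm]
        exact this)
    have h0 : φ (x 0) = q • x 1 := by
      simpa [Fintype.linearCombination_apply] using hφ (Pi.single 0 1)
    have := key ![φ, -(q • LinearMap.id)] (by simp [h0]) 1 p hp
    refine hz ?_
    simpa using LinearMap.congr_fun this z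

theorem baseChange_mkQ_eq_zero_iff {R S M : Type*} [CommRing R] [CommRing S] [Algebra R S]
    [AddCommGroup M] [Module R M] {a : R} {x : S ⊗[R] M} :
    (Submodule.mkQ (a • (⊤ : Submodule R M))).baseChange S x = 0 ↔
      x ∈ algebraMap R S a • (⊤ : Submodule S (S ⊗[R] M)) := by
  have hex := lTensor_exact S (LinearMap.exact_subtype_mkQ (a • (⊤ : Submodule R M)))
    (Submodule.mkQ_surjective _)
  have h0 : ∀ y : S ⊗[R] M,
      (Submodule.mkQ (a • (⊤ : Submodule R M))).lTensor S (algebraMap R S a • y) = 0 := by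
    intro y
    rw [algebraMap_smul, map_smul]
    induction y with
    | zero => simp
    | add u v hu hv => rw [map_add, smul_add, hu, hv, add_zero]
    | tmul s m =>
      rw [LinearMap.lTensor_tmul, ← TensorProduct.tmul_smul,
        ← (Submodule.mkQ _).map_smul, Submodule.mkQ_apply,
        (Submodule.Quotient.mk_eq_zero _).2 (mem_smul_top_iff.2 ⟨m, rfl⟩), TensorProduct.tmul_zero]
  rw [LinearMap.baseChange_eq_ltensor]
  constructor
  · intro hx
    obtain ⟨y, rfl⟩ := (hex x).1 hx
    clear hx
    induction y with
    | zero => simp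
    | add u v hu hv => rw [map_add]; exact add_mem hu hv
    | tmul s m =>
      obtain ⟨_, hm⟩ := m
      obtain ⟨m, rfl⟩ := mem_smul_top_iff.1 hm
      exact mem_smul_top_iff.2 ⟨s ⊗ₜ m, by simp [algebraMap_smul]⟩
  · intro h
    obtain ⟨y, rfl⟩ := mem_smul_top_iff.1 h
    exact h0 y

/-- Base change commutes with reduction modulo an element. -/
def quotSMulTopBaseChange (R S M : Type*) [CommRing R] [CommRing S] [Algebra R S]
    [AddCommGroup M] [Module R M] (a : R) :
    ((S ⊗[R] M) ⧸ (algebraMap R S a • (⊤ : Submodule S (S ⊗[R] M)))) ≃ₗ[S]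
      S ⊗[R] (M ⧸ (a • (⊤ : Submodule R M))) :=
  (Submodule.quotEquivOfEq _ _ (by ext x; exact baseChange_mkQ_eq_zero_iff.symm)) ≪≫ₗ
    ((Submodule.mkQ (a • (⊤ : Submodule R M))).baseChange S).quotKerEquivOfSurjective
      (by
        rw [LinearMap.baseChange_eq_ltensor]
        exact LinearMap.lTensor_surjective _ (Submodule.mkQ_surjective _))

theorem quotSMulTopBaseChange_mk {R S M : Type*} [CommRing R] [CommRing S] [Algebra R S]
    [AddCommGroup M] [Module R M] (a : R) (x : S ⊗[R] M) :
    quotSMulTopBaseChange R S M a (Submodule.Quotient.mk x) =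
      (Submodule.mkQ (a • (⊤ : Submodule R M))).baseChange S x := rfl

theorem EndLifts.baseChange {R M : Type*} (S : Type*) [CommRing R] [CommRing S] [Algebra R S]
    [Module.Flat R S] [AddCommGroup M] [Module R M] [Module.FinitePresentation R M] {a : R}
    (h : EndLifts R M a) : EndLifts S (S ⊗[R] M) (algebraMap R S a) := by
  intro φ
  have key : ∀ ψ : S ⊗[R] M →ₗ[S] S ⊗[R] (M ⧸ (a • (⊤ : Submodule R M))),
      ∃ H : S ⊗[R] M →ₗ[S] S ⊗[R] M,
        (Submodule.mkQ (a • (⊤ : Submodule R M))).baseChange S ∘ₗ H = ψ := by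
    intro ψ
    refine IsBaseChange.inductionOn (Module.FinitePresentation.isBaseChange_map R M
      (M ⧸ (a • (⊤ : Submodule R M))) S) ψ
      (fun ψ => ∃ H : S ⊗[R] M →ₗ[S] S ⊗[R] M,
        (Submodule.mkQ (a • (⊤ : Submodule R M))).baseChange S ∘ₗ H = ψ) ?_ ?_ ?_ ?_
    · exact ⟨0, LinearMap.comp_zero _⟩
    · intro f
      obtain ⟨H, hH⟩ := h f
      refine ⟨H.baseChange S, ?_⟩
      rw [← LinearMap.baseChange_comp]
      exact congrArg (LinearMap.baseChange S) (LinearMap.ext hH)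
    · rintro s f ⟨H, rfl⟩
      exact ⟨s • H, LinearMap.comp_smul _ _ _⟩
    · rintro f g ⟨H, rfl⟩ ⟨K, rfl⟩
      exact ⟨H + K, LinearMap.comp_add _ _ _⟩
  obtain ⟨H, hH⟩ := key ((quotSMulTopBaseChange R S M a).toLinearMap ∘ₗ φ)
  refine ⟨H, fun x => (quotSMulTopBaseChange R S M a).injective ?_⟩
  rw [quotSMulTopBaseChange_mk]
  exact LinearMap.congr_fun hH x

theorem EndLifts.of_mul {S E : Type*} [CommRing S] [AddCommGroup E] [Module S E] {α c : S}
    (hc : ∀ x : E, c • x = 0 → x = 0) (h : EndLifts S E (α * c)) : EndLifts S E α := by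
  intro φ
  let μ : (E ⧸ (α • (⊤ : Submodule S E))) →ₗ[S] E ⧸ ((α * c) • (⊤ : Submodule S E)) :=
    Submodule.mapQ _ _ (LinearMap.lsmul S E c) (by
      intro x hx
      obtain ⟨y, rfl⟩ := mem_smul_top_iff.1 hx
      exact mem_smul_top_iff.2 ⟨y, (mul_smul α c y).trans (smul_comm α c y)⟩)
  have hμ : ∀ x, μ (Submodule.Quotient.mk x) = Submodule.Quotient.mk (c • x) := fun x => rfl
  obtain ⟨H, hH⟩ := h (μ ∘ₗ φ)
  have inj : ∀ {x y : E}, c • x = c • y → x = y := fun {x y} h =>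
    sub_eq_zero.1 (hc _ (by rw [smul_sub, h, sub_self]))
  have key : ∀ x, ∃ y, H x = c • y ∧ Submodule.Quotient.mk y = φ x := by
    intro x
    obtain ⟨z, hz⟩ := Submodule.Quotient.mk_surjective _ (φ x)
    have h1 := hH x
    rw [LinearMap.comp_apply, ← hz, hμ] at h1
    obtain ⟨y, hy⟩ := mem_smul_top_iff.1 ((Submodule.Quotient.eq _).1 h1)
    refine ⟨z + α • y, ?_, ?_⟩
    · rw [smul_add, smul_smul, mul_comm c, hy, add_sub_cancel]
    · rw [← hz, Submodule.Quotient.eq, add_sub_cancel_left]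
      exact mem_smul_top_iff.2 ⟨y, rfl⟩
  choose K hK1 hK2 using key
  exact ⟨{ toFun := K
           map_add' := fun x y => inj (by rw [← hK1, map_add, hK1, hK1, smul_add])
           map_smul' := fun r x => inj (by
             rw [← hK1, map_smul, hK1, RingHom.id_apply, smul_comm]) }, hK2⟩

theorem length_end_quotient_le {S E : Type*} [CommRing S] [AddCommGroup E] [Module S E] {α : S}
    (h : EndLifts S E α) :
    Module.length S (Module.End S (E ⧸ (α • (⊤ : Submodule S E)))) ≤
      Module.length S (Module.End S E ⧸ (α • (⊤ : Submodule S (Module.End S E)))) := by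
  let q : Module.End S E →ₗ[S] Module.End S (E ⧸ (α • (⊤ : Submodule S E))) :=
    { toFun := fun f => Submodule.mapQ _ _ f (by
        intro x hx
        obtain ⟨y, rfl⟩ := mem_smul_top_iff.1 hx
        exact mem_smul_top_iff.2 ⟨f y, by simp⟩)
      map_add' := fun f g => by ext x; rfl
      map_smul' := fun c f => by ext x; rfl }
  have hq : Function.Surjective q := by
    intro φ
    obtain ⟨H, hH⟩ := h (φ ∘ₗ Submodule.mkQ _)
    refine ⟨H, ?_⟩
    ext x
    exact hH x
  refine Module.length_le_of_surjective (Submodule.liftQ _ q ?_) fun φ => ?_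
  · intro f hf
    obtain ⟨g, rfl⟩ := mem_smul_top_iff.1 hf
    rw [LinearMap.mem_ker]
    ext x
    exact (Submodule.Quotient.mk_eq_zero _).2 (mem_smul_top_iff.2 ⟨g x, rfl⟩)
  · obtain ⟨f, rfl⟩ := hq φ
    exact ⟨Submodule.Quotient.mk f, rfl⟩

/-- The socle modulo a factor of an element is at least as long as the socle modulo the
element. -/
theorem length_socle_quotient_mul_le {S E : Type*} [CommRing S] [IsLocalRing S] [AddCommGroup E]
    [Module S E] {α c : S} (hα : α ∈ maximalIdeal S) (hα0 : ∀ x : E, α • x = 0 → x = 0)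
    (hc : ∀ x : E, c • x = 0 → x = 0) :
    Module.length S (socle S (E ⧸ ((α * c) • (⊤ : Submodule S E)))) ≤
      Module.length S (socle S (E ⧸ (α • (⊤ : Submodule S E)))) := by
  let μ : (E ⧸ (α • (⊤ : Submodule S E))) →ₗ[S] E ⧸ ((α * c) • (⊤ : Submodule S E)) :=
    Submodule.mapQ _ _ (LinearMap.lsmul S E c) (by
      intro x hx
      obtain ⟨y, rfl⟩ := mem_smul_top_iff.1 hx
      exact mem_smul_top_iff.2 ⟨y, (mul_smul α c y).trans (smul_comm α c y)⟩)
  have hμ : ∀ x, μ (Submodule.Quotient.mk x) = Submodule.Quotient.mk (c • x) := fun x => rfl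
  have inj : ∀ {x y : E}, c • x = c • y → x = y := fun {x y} h =>
    sub_eq_zero.1 (hc _ (by rw [smul_sub, h, sub_self]))
  have injα : ∀ {x y : E}, α • x = α • y → x = y := fun {x y} h =>
    sub_eq_zero.1 (hα0 _ (by rw [smul_sub, h, sub_self]))
  refine Module.length_le_of_surjective (μ.restrict (p := socle S _) (q := socle S _)
    fun x hx d hd => by rw [← map_smul, hx d hd, map_zero]) ?_
  rintro ⟨z, hz⟩
  obtain ⟨z, rfl⟩ := Submodule.Quotient.mk_surjective _ z
  obtain ⟨y, hy⟩ := mem_smul_top_iff.1 ((Submodule.Quotient.mk_eq_zero _).1 (hz α hα))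
  rw [mul_smul] at hy
  obtain rfl := injα hy
  refine ⟨⟨Submodule.Quotient.mk y, fun d hd => ?_⟩, rfl⟩
  obtain ⟨w, hw⟩ := mem_smul_top_iff.1 ((Submodule.Quotient.mk_eq_zero _).1 (hz d hd))
  refine (Submodule.Quotient.mk_eq_zero _).2 (mem_smul_top_iff.2 ⟨w, inj ?_⟩)
  have hw' : (α * c) • w = d • c • y := hw
  change c • α • w = c • d • y
  rw [smul_comm c d y, ← hw', smul_smul, mul_comm]

section BaseChange

variable {R S : Type*} [CommRing R] [IsLocalRing R] [CommRing S] [IsLocalRing S] [Algebra R S]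

theorem length_baseChange_of_map_maximalIdeal_eq [Module.Flat R S]
    (hm : (maximalIdeal R).map (algebraMap R S) = maximalIdeal S) (M : Type*) [AddCommGroup M]
    [Module R M] : Module.length S (S ⊗[R] M) = Module.length R M := by
  have : IsLocalHom (algebraMap R S) := by
    refine ⟨fun x hx => ?_⟩
    by_contra h
    exact (mem_maximalIdeal _).1 (hm ▸ Ideal.mem_map_of_mem _ ((mem_maximalIdeal _).2 h)) hx
  have hs : IsSimpleModule S (S ⧸ maximalIdeal S) := by
    rw [isSimpleModule_iff_isCoatom]
    exact (maximalIdeal.isMaximal S).out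
  rw [IsLocalRing.length_baseChange, hm, Module.length_eq_one S (S ⧸ maximalIdeal S), mul_one]

theorem smul_baseChange_eq_zero (hm : (maximalIdeal R).map (algebraMap R S) = maximalIdeal S)
    {N : Type*} [AddCommGroup N] [Module R N] (hN : ∀ c ∈ maximalIdeal R, ∀ x : N, c • x = 0)
    {c : S} (hc : c ∈ maximalIdeal S) (x : S ⊗[R] N) : c • x = 0 := by
  rw [← hm] at hc
  refine Submodule.span_induction (p := fun c _ => c • x = 0) ?_ (zero_smul _ _) ?_ ?_ hc
  · rintro _ ⟨d, hd, rfl⟩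
    rw [algebraMap_smul]
    induction x with
    | zero => simp
    | add u v hu hv => rw [smul_add, hu, hv, add_zero]
    | tmul s n => rw [← TensorProduct.tmul_smul, hN d hd, TensorProduct.tmul_zero]
  · intro u v _ _ hu hv
    rw [add_smul, hu, hv, add_zero]
  · intro u v _ hv
    rw [smul_assoc, hv, smul_zero]

theorem length_le_length_socle_baseChange [Module.Flat R S]
    (hm : (maximalIdeal R).map (algebraMap R S) = maximalIdeal S) {M : Type*} [AddCommGroup M]
    [Module R M] :
    Module.length R (socle R M) ≤ Module.length S (socle S (S ⊗[R] M)) := by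
  rw [← length_baseChange_of_map_maximalIdeal_eq hm]
  refine Module.length_le_of_injective
    (((socle R M).subtype.baseChange S).codRestrict (socle S (S ⊗[R] M)) fun x c hc => ?_) ?_
  · rw [← map_smul, smul_baseChange_eq_zero (N := socle R M) hm
      (fun c hc x => Subtype.ext ((mem_socle.1 x.2) c hc)) hc, map_zero]
  · intro x y hxy
    refine Module.Flat.lTensor_preserves_injective_linearMap (M := S) (socle R M).subtype
      Subtype.val_injective ?_
    exact congrArg Subtype.val hxy

theorem length_le_of_surjective_of_smul_eq_zero {S M N : Type*} [CommRing S] [IsLocalRing S]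
    [AddCommGroup M] [Module S M] [AddCommGroup N] [Module S N] {p : M →ₗ[S] N}
    (hp : Function.Surjective p) (hN : ∀ c ∈ maximalIdeal S, ∀ x : N, c • x = 0) {α : S}
    (hα : α ∈ maximalIdeal S) :
    Module.length S N ≤ Module.length S ((M ⧸ (α • (⊤ : Submodule S M))) ⧸ (maximalIdeal S •
      (⊤ : Submodule S (M ⧸ (α • (⊤ : Submodule S M)))))) := by
  have hpα : α • (⊤ : Submodule S M) ≤ LinearMap.ker p := by
    intro x hx
    obtain ⟨x, rfl⟩ := mem_smul_top_iff.1 hx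
    rw [LinearMap.mem_ker, map_smul]
    exact hN α hα _
  refine Module.length_le_of_surjective (Submodule.liftQ _ (Submodule.liftQ _ p hpα) ?_) fun y => ?_
  · rw [Submodule.smul_le]
    intro c hc x _
    rw [LinearMap.mem_ker, map_smul]
    exact hN c hc _
  · obtain ⟨x, rfl⟩ := hp y
    exact ⟨Submodule.Quotient.mk (Submodule.Quotient.mk x), rfl⟩

theorem length_quotient_maximalIdeal_smul_le
    (hm : (maximalIdeal R).map (algebraMap R S) = maximalIdeal S)
    [Module.Flat R S] {M : Type*} [AddCommGroup M] [Module R M] {α : S} (hα : α ∈ maximalIdeal S) :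
    Module.length R (M ⧸ (maximalIdeal R • (⊤ : Submodule R M))) ≤
      Module.length S (((S ⊗[R] M) ⧸ (α • (⊤ : Submodule S (S ⊗[R] M)))) ⧸ (maximalIdeal S •
        (⊤ : Submodule S ((S ⊗[R] M) ⧸ (α • (⊤ : Submodule S (S ⊗[R] M))))))) := by
  rw [← length_baseChange_of_map_maximalIdeal_eq hm]
  have hN : ∀ c ∈ maximalIdeal R, ∀ x : M ⧸ (maximalIdeal R • (⊤ : Submodule R M)), c • x = 0 := by
    intro c hc x
    obtain ⟨x, rfl⟩ := Submodule.Quotient.mk_surjective _ x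
    exact (Submodule.Quotient.mk_eq_zero _).2 (Submodule.smul_mem_smul hc Submodule.mem_top)
  exact length_le_of_surjective_of_smul_eq_zero
    (p := (Submodule.mkQ (maximalIdeal R • (⊤ : Submodule R M))).baseChange S)
    (LinearMap.lTensor_surjective _ (Submodule.mkQ_surjective _))
    (fun c hc x => smul_baseChange_eq_zero hm hN hc x) hα

end BaseChange

theorem two_le_length_quotient_maximalIdeal_smul {R : Type*} [CommRing R] [IsLocalRing R]
    [IsNoetherianRing R] {I : Ideal R} (hI : ¬ ∃ x, I = Ideal.span {x}) :
    2 ≤ Module.length R (I ⧸ (maximalIdeal R • (⊤ : Submodule R I))) := by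
  by_contra! h
  obtain ⟨r, x, π, hspan, -, hlen⟩ := exists_generators_and_coordinates (S := R) (M := I)
  rw [hlen] at h
  have hr : r < 2 := by exact_mod_cast h
  refine hI ?_
  have hI' : I = Ideal.span (Set.range fun i => (x i : R)) := by
    have h1 := congrArg (Submodule.map I.subtype) hspan
    rw [Submodule.map_span, Submodule.map_subtype_top, ← Set.range_comp] at h1
    exact h1.symm
  interval_cases r
  · refine ⟨0, hI'.trans ?_⟩
    rw [Set.range_eq_empty]
    simp
  · refine ⟨x 0, hI'.trans ?_⟩
    rw [Set.range_unique]
    rfl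

theorem length_end_quotient_eq {S E : Type*} [CommRing S] [AddCommGroup E] [Module S E]
    {j : E →ₗ[S] S} (hj : Function.Injective j) {b : S} (hb : ∀ x : S, b * x = 0 → x = 0)
    {x₀ : E} (hx₀ : j x₀ = b) (hfin : Module.length S (S ⧸ Ideal.span {b}) ≠ ⊤) {α : S}
    (hα : ∀ x : S, α * x = 0 → x = 0) :
    Module.length S (Module.End S E ⧸ (α • (⊤ : Submodule S (Module.End S E)))) =
      Module.length S (S ⧸ (α • (⊤ : Submodule S S))) := by
  let ev : Module.End S E →ₗ[S] S := j ∘ₗ LinearMap.applyₗ x₀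
  have hev : ∀ f, ev f = j (f x₀) := fun f => rfl
  refine length_quotient_smul_top_eq (j := ev) ?_ ?_ hα
  · refine (injective_iff_map_eq_zero _).2 fun f hf => LinearMap.ext fun y => hj ?_
    rw [LinearMap.zero_apply, map_zero]
    refine hb _ ?_
    rw [← smul_eq_mul, ← map_smul, ← map_smul]
    have : b • y = j y • x₀ :=
      hj (by rw [map_smul, map_smul, hx₀, smul_eq_mul, smul_eq_mul, mul_comm])
    rw [this, map_smul, map_smul, ← hev, hf, smul_zero]
  · refine ne_top_of_le_ne_top hfin (Module.length_le_of_surjective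
      (Submodule.factor (p := Ideal.span {b}) ?_) (Submodule.factor_surjective _))
    rw [Ideal.span_singleton_le_iff_mem]
    exact ⟨LinearMap.id, hx₀⟩

/-- The ideal of a flat local extension with the same maximal ideal cannot have both
liftable endomorphisms and a noncyclic quotient of small length. -/
theorem false_of_flat_of_length_le_six {R S : Type*} [CommRing R] [IsLocalRing R]
    [IsNoetherianRing R] [CommRing S] [IsLocalRing S] [Algebra R S] [Module.Flat R S]
    (hm : (maximalIdeal R).map (algebraMap R S) = maximalIdeal S) {I : Ideal R} {a b : R}
    (ha : a ∈ nonZeroDivisors R) (hb : b ∈ nonZeroDivisors R) (hbI : b ∈ I)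
    (hbfin : Module.length R (R ⧸ Ideal.span {b}) ≠ ⊤) (hlift : EndLifts R I a)
    (hsoc : 2 ≤ Module.length R (socle R (I ⧸ (a • (⊤ : Submodule R I)))))
    (hI : ¬ ∃ x, I = Ideal.span {x}) {α c : S} (hαc : α * c = algebraMap R S a)
    (hα : α ∈ maximalIdeal S) {e : ℕ} (he : e ≤ 6)
    (hlen : Module.length S (S ⧸ Ideal.span {α}) = e) : False := by
  have hreg : ∀ {d : R}, d ∈ nonZeroDivisors R → ∀ x : S, algebraMap R S d * x = 0 → x = 0 := by
    intro d hd x hx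
    refine Module.Flat.isSMulRegular_of_nonZeroDivisors (M := S) hd ?_
    change d • x = d • 0
    rw [smul_zero, Algebra.smul_def, hx]
  have hα0 : ∀ x : S, α * x = 0 → x = 0 := fun x hx =>
    hreg ha x (by rw [← hαc, mul_right_comm, hx, zero_mul])
  have hc0 : ∀ x : S, c * x = 0 → x = 0 := fun x hx =>
    hreg ha x (by rw [← hαc, mul_assoc, hx, mul_zero])
  let j : S ⊗[R] I →ₗ[S] S :=
    (AlgebraTensorModule.rid R S S).toLinearMap ∘ₗ I.subtype.baseChange S
  have hj : Function.Injective j := (AlgebraTensorModule.rid R S S).injective.comp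
    (Module.Flat.lTensor_preserves_injective_linearMap (M := S) I.subtype Subtype.val_injective)
  have hx₀ : j (1 ⊗ₜ ⟨b, hbI⟩) = algebraMap R S b := by
    simp [j, Algebra.smul_def]
  have hfin : Module.length S (S ⧸ Ideal.span {algebraMap R S b}) ≠ ⊤ := by
    have h := (Algebra.TensorProduct.quotIdealMapEquivTensorQuot S
      (Ideal.span {b})).toLinearEquiv.length_eq
    rw [length_baseChange_of_map_maximalIdeal_eq hm, Ideal.map_span, Set.image_singleton] at h
    rw [h]
    exact hbfin
  have hE0 : ∀ {d : S}, (∀ x : S, d * x = 0 → x = 0) → ∀ x : S ⊗[R] I, d • x = 0 → x = 0 := by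
    intro d hd x hx
    refine hj ((hd _ ?_).trans (map_zero j).symm)
    rw [← smul_eq_mul, ← map_smul, hx, map_zero]
  have hspan : α • (⊤ : Submodule S S) = Ideal.span {α} := by
    ext x
    rw [mem_smul_top_iff, Ideal.mem_span_singleton']
    simp [mul_comm]
  have hEα : Module.length S ((S ⊗[R] I) ⧸ (α • (⊤ : Submodule S (S ⊗[R] I)))) = e := by
    rw [length_quotient_smul_top_eq hj _ hα0, hspan, hlen]
    refine ne_top_of_le_ne_top hfin (Module.length_le_of_surjective
      (Submodule.factor (p := Ideal.span {algebraMap R S b}) ?_) (Submodule.factor_surjective _))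
    rw [Ideal.span_singleton_le_iff_mem]
    exact ⟨_, hx₀⟩
  have hFP : Module.FinitePresentation R I := Module.finitePresentation_of_finite R I
  have hliftα : EndLifts S (S ⊗[R] I) α := EndLifts.of_mul (hE0 hc0) (hαc ▸ hlift.baseChange S)
  refine not_length_end_le he hEα ?_ ?_ ?_
  · refine (length_end_quotient_le hliftα).trans (le_of_eq ?_)
    rw [length_end_quotient_eq hj (hreg hb) hx₀ hfin hα0, hspan, hlen]
  · exact (two_le_length_quotient_maximalIdeal_smul hI).trans
      (length_quotient_maximalIdeal_smul_le hm hα)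
  · refine hsoc.trans ((length_le_length_socle_baseChange (S := S) hm).trans ?_)
    refine le_trans ?_ (length_socle_quotient_mul_le hα (hE0 hα0) (hE0 hc0))
    rw [hαc]
    let φ := (quotSMulTopBaseChange R S I a).symm
    refine Module.length_le_of_injective (φ.toLinearMap.restrict (p := socle S _) (q := socle S _)
      fun x hx d hd => ?_) fun x y hxy => ?_
    · rw [← map_smul, hx d hd, map_zero]
    · exact Subtype.ext (φ.injective (congrArg Subtype.val hxy))

/-- High powers of an ideal have no socle modulo the second next power. -/
theorem exists_forall_mem_pow_succ_of_forall_mul_mem {R : Type*} [CommRing R] [IsNoetherianRing R]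
    (I : Ideal R) : ∃ N₀, ∀ N ≥ N₀, ∀ u ∈ I ^ N, (∀ c ∈ I, c * u ∈ I ^ (N + 2)) →
      u ∈ I ^ (N + 1) := by
  let F : I.Filtration R :=
    { N := fun n =>
        { carrier := {u | u ∈ I ^ n ∧ ∀ c ∈ I, c * u ∈ I ^ (n + 2)}
          add_mem' := fun {u v} hu hv => ⟨add_mem hu.1 hv.1, fun c hc => by
            rw [mul_add]; exact add_mem (hu.2 c hc) (hv.2 c hc)⟩
          zero_mem' := ⟨zero_mem _, fun c _ => by rw [mul_zero]; exact zero_mem _⟩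
          smul_mem' := fun r u hu => ⟨Ideal.mul_mem_left _ _ hu.1, fun c hc => by
            rw [smul_eq_mul, mul_left_comm]; exact Ideal.mul_mem_left _ _ (hu.2 c hc)⟩ }
      mono := fun n u hu => ⟨Ideal.pow_le_pow_right n.le_succ hu.1, fun c hc =>
        Ideal.pow_le_pow_right (by omega) (hu.2 c hc)⟩
      smul_le := fun n => by
        rw [Submodule.smul_le]
        refine fun d hd u hu => ⟨Ideal.pow_le_pow_right (by omega) (hu.2 d hd), fun c hc => ?_⟩
        rw [show n + 1 + 2 = n + 2 + 1 by omega, pow_succ', smul_eq_mul]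
        exact Ideal.mul_mem_mul hc (hu.2 d hd) }
  have hF : F.Stable := (I.stableFiltration_stable ⊤).of_le fun n u hu => by
    change u ∈ I ^ n • (⊤ : Submodule R R)
    rw [smul_eq_mul, Ideal.mul_top]
    exact hu.1
  obtain ⟨n₀, hn₀⟩ := hF
  refine ⟨n₀ + 1, fun N hN u hu hmu => ?_⟩
  obtain ⟨N, rfl⟩ : ∃ k, N = k + 1 := ⟨N - 1, by omega⟩
  have hmem : u ∈ F.N (N + 1) := ⟨hu, hmu⟩
  rw [← hn₀ N (by omega)] at hmem
  refine (Submodule.smul_le.2 fun c hc v hv => ?_ : I • F.N N ≤ _) hmem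
  exact hv.2 c hc

open Polynomial in
/-- A polynomial whose coefficients generate `I` acts superficially on high powers of `I`. -/
theorem mem_map_C_pow_succ_of_mul_mem {R : Type*} [CommRing R] {I : Ideal R} {f : R[X]}
    (hf : Ideal.span (Set.range f.coeff) = I) {N₀ : ℕ}
    (hsoc : ∀ N ≥ N₀, ∀ u ∈ I ^ N, (∀ c ∈ I, c * u ∈ I ^ (N + 2)) → u ∈ I ^ (N + 1)) {N : ℕ}
    (hN : N₀ ≤ N) {g : R[X]} (hg : g ∈ (I ^ N).map C) (hfg : f * g ∈ (I ^ (N + 2)).map C) :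
    g ∈ (I ^ (N + 1)).map C := by
  have hfI : ∀ i, f.coeff i ∈ I := fun i => hf ▸ Ideal.subset_span ⟨i, rfl⟩
  have hmul : ∀ {p q : R[X]} {k : ℕ}, p ∈ I.map C → q ∈ (I ^ k).map C →
      p * q ∈ (I ^ (k + 1)).map C := by
    intro p q k hp hq
    rw [pow_succ', Ideal.map_mul]
    exact Ideal.mul_mem_mul hp hq
  have main : ∀ n N : ℕ, N₀ ≤ N → ∀ g : R[X], (∀ i, n ≤ i → g.coeff i = 0) →
      g ∈ (I ^ N).map C → f * g ∈ (I ^ (N + 2)).map C → g ∈ (I ^ (N + 1)).map C := by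
    intro n
    induction n with
    | zero =>
      intro N _ g h0 _ _
      have : g = 0 := Polynomial.ext fun i => h0 i i.zero_le
      rw [this]
      exact zero_mem _
    | succ n ih =>
      intro N hN g h0 hg hfg
      have key : ∀ k i, f.natDegree < i + k → C (f.coeff i) * g ∈ (I ^ (N + 2)).map C := by
        intro k
        induction k with
        | zero =>
          intro i hi
          rw [coeff_eq_zero_of_natDegree_lt (by omega), C_0, zero_mul]
          exact zero_mem _
        | succ k ihk =>
          intro i hi
          have hlead : f.coeff i * g.coeff n ∈ I ^ (N + 2) := by
            have h1 := Ideal.mem_map_C_iff.1 hfg (i + n)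
            rw [coeff_mul, ← Finset.add_sum_erase _ _
              (show (i, n) ∈ Finset.HasAntidiagonal.antidiagonal (i + n) by simp)] at h1
            refine (Submodule.add_mem_iff_left _ (Submodule.sum_mem _ fun pq hpq => ?_)).1 h1
            obtain ⟨hne, hpq⟩ := Finset.mem_erase.1 hpq
            have hsum := Finset.HasAntidiagonal.mem_antidiagonal.1 hpq
            rcases lt_trichotomy pq.2 n with h | h | h
            · have := Ideal.mem_map_C_iff.1 (ihk pq.1 (by omega)) pq.2
              rwa [coeff_C_mul] at this
            · exact absurd (Prod.ext (by simp only; omega) h) hne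
            · rw [h0 _ h, mul_zero]
              exact zero_mem _
          have hmon : monomial n (f.coeff i * g.coeff n) ∈ (I ^ (N + 2)).map C := by
            refine Ideal.mem_map_C_iff.2 fun p => ?_
            rw [coeff_monomial]
            split_ifs
            · exact hlead
            · exact zero_mem _
          have hCi : C (f.coeff i) ∈ I.map C := Ideal.mem_map_of_mem _ (hfI i)
          have hg1 : C (f.coeff i) * g - monomial n (f.coeff i * g.coeff n) ∈
              (I ^ (N + 1 + 1)).map C := by
            refine ih (N + 1) (by omega) _ (fun p hp => ?_) ?_ ?_
            · rw [coeff_sub, coeff_C_mul, coeff_monomial]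
              split_ifs with h
              · rw [h, sub_self]
              · rw [h0 p (by omega), mul_zero, sub_zero]
            · exact sub_mem (hmul hCi hg) (Ideal.map_mono (Ideal.pow_le_pow_right (by omega)) hmon)
            · rw [mul_sub, mul_left_comm]
              exact sub_mem (hmul hCi hfg) (hmul (Ideal.mem_map_C_iff.2 hfI) hmon)
          have := add_mem hg1 hmon
          rwa [sub_add_cancel] at this
      refine Ideal.mem_map_C_iff.2 fun q => hsoc N hN _ (Ideal.mem_map_C_iff.1 hg q) fun c hc => ?_
      rw [← hf] at hc
      refine Submodule.span_induction (p := fun c _ => c * g.coeff q ∈ I ^ (N + 2)) ?_ ?_ ?_ ?_ hc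
      · rintro _ ⟨i, rfl⟩
        have := Ideal.mem_map_C_iff.1 (key (f.natDegree + 1) i (by omega)) q
        rwa [coeff_C_mul] at this
      · rw [zero_mul]
        exact zero_mem _
      · intro x y _ _ hx hy
        rw [add_mul]
        exact add_mem hx hy
      · intro r x _ hx
        rw [smul_mul_assoc]
        exact Ideal.mul_mem_left _ _ hx
  exact main (g.natDegree + 1) N hN g (fun i hi => coeff_eq_zero_of_natDegree_lt hi) hg hfg

open Polynomial in
theorem exists_span_range_coeff_eq {R : Type*} [CommRing R] {I : Ideal R} (hI : I.FG) :
    ∃ f : R[X], Ideal.span (Set.range f.coeff) = I := by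
  classical
  obtain ⟨n, s, hs⟩ := Submodule.fg_iff_exists_fin_generating_family.1 hI
  refine ⟨ofFn n s, le_antisymm (Ideal.span_le.2 ?_) ?_⟩
  · rintro _ ⟨i, rfl⟩
    by_cases hi : i < n
    · rw [ofFn_coeff_eq_val_of_lt s hi]
      exact hs ▸ Submodule.subset_span ⟨_, rfl⟩
    · rw [ofFn_coeff_eq_zero_of_ge s (by omega)]
      exact zero_mem _
  · rw [← hs]
    refine Submodule.span_mono ?_
    rintro _ ⟨i, rfl⟩
    exact ⟨i, ofFn_coeff_eq_val_of_lt s i.2⟩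

/-- If multiplication by `α` is injective on the associated graded ring in high degrees and
the Hilbert function is eventually constant, then `α` is a parameter computing the
multiplicity. -/
theorem length_quotient_span_singleton_eq {S : Type*} [CommRing S] [IsLocalRing S]
    [IsNoetherianRing S] {α d : S} (hα : α ∈ maximalIdeal S) (hd : d ∈ maximalIdeal S)
    (hd0 : d ∈ nonZeroDivisors S) {N e : ℕ}
    (hfin : ∀ n, Module.length S (S ⧸ maximalIdeal S ^ n) ≠ ⊤)
    (hlen : ∀ n ≥ N, Module.length S (S ⧸ maximalIdeal S ^ (n + 1)) =
      Module.length S (S ⧸ maximalIdeal S ^ n) + e)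
    (hsup : ∀ u ∈ maximalIdeal S ^ N, α * u ∈ maximalIdeal S ^ (N + 2) →
      u ∈ maximalIdeal S ^ (N + 1)) :
    (∃ c, α * c = d ^ (N + 1)) ∧ Module.length S (S ⧸ Ideal.span {α}) = e := by
  let A : ∀ n : ℕ, Submodule S ↥(maximalIdeal S ^ n) := fun n =>
    Submodule.comap (maximalIdeal S ^ n).subtype (maximalIdeal S ^ (n + 1))
  have hA : ∀ n ≥ N, Module.length S (↥(maximalIdeal S ^ n) ⧸ A n) = e := by
    intro n hn
    have h := length_quotient_map_eq_add (j := (maximalIdeal S ^ n).subtype)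
      Subtype.val_injective (A n)
    rw [Submodule.map_comap_subtype, inf_eq_right.2 (Ideal.pow_le_pow_right n.le_succ),
      Submodule.range_subtype, hlen n hn,
      add_comm (Module.length S (↥(maximalIdeal S ^ n) ⧸ A n))] at h
    exact ((WithTop.add_left_inj (hfin n)).1 h).symm
  let μ : ↥(maximalIdeal S ^ N) →ₗ[S] ↥(maximalIdeal S ^ (N + 1)) :=
    (LinearMap.lsmul S S α).restrict fun x hx => by
      rw [pow_succ']
      exact Ideal.mul_mem_mul hα hx
  have hμA : A N ≤ (A (N + 1)).comap μ := by
    intro x hx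
    change α * x.1 ∈ maximalIdeal S ^ (N + 1 + 1)
    rw [pow_succ']
    exact Ideal.mul_mem_mul hα hx
  have hsurj : Function.Surjective (Submodule.mapQ _ _ μ hμA) := by
    refine surjective_of_injective_of_length_eq ?_ ((hA N le_rfl).trans (hA _ N.le_succ).symm)
      ((hA _ N.le_succ).trans_ne (ENat.natCast_ne_top e))
    rw [← LinearMap.ker_eq_bot, Submodule.ker_mapQ, eq_bot_iff,
      Submodule.map_le_iff_le_comap]
    intro x hx
    exact (Submodule.Quotient.mk_eq_zero (A N)).2 (hsup x.1 x.2 hx)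
  have hle : maximalIdeal S ^ (N + 1) ≤ α • (maximalIdeal S ^ N) := by
    refine Submodule.le_of_le_smul_of_le_jacobson_bot (I := maximalIdeal S)
      (IsNoetherian.noetherian _) (maximalIdeal_le_jacobson _) ?_
    intro x hx
    obtain ⟨y, hy⟩ := hsurj (Submodule.Quotient.mk ⟨x, hx⟩)
    obtain ⟨y, rfl⟩ := Submodule.Quotient.mk_surjective _ y
    have h1 : x - α * y.1 ∈ maximalIdeal S ^ (N + 1 + 1) :=
      (Submodule.Quotient.eq (A (N + 1))).1 hy.symm
    rw [← add_sub_cancel (α * y.1) x]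
    refine Submodule.add_mem_sup (Submodule.smul_mem_pointwise_smul _ _ _ y.2) ?_
    rwa [smul_eq_mul, ← pow_succ']
  have hex : ∀ x ∈ maximalIdeal S ^ (N + 1), ∃ y ∈ maximalIdeal S ^ N, α * y = x := fun x hx =>
    Submodule.mem_smul_pointwise_iff_exists _ _ _ |>.1 (hle hx)
  obtain ⟨c, -, hc⟩ := hex _ (Ideal.pow_mem_pow hd (N + 1))
  refine ⟨⟨c, hc⟩, ?_⟩
  have hα0 : ∀ x : S, α • x = 0 → x = 0 := by
    intro x hx
    refine (mul_right_mem_nonZeroDivisors_eq_zero_iff (pow_mem hd0 (N + 1))).1 ?_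
    rw [← hc, mul_comm, mul_right_comm, ← smul_eq_mul α x, hx, zero_mul]
  have h := length_quotient_smul_top_eq (j := (maximalIdeal S ^ N).subtype)
    Subtype.val_injective (by rw [Submodule.range_subtype]; exact hfin N) hα0
  have hAN : α • (⊤ : Submodule S ↥(maximalIdeal S ^ N)) = A N := by
    ext x
    rw [mem_smul_top_iff]
    constructor
    · rintro ⟨y, rfl⟩
      change α * y.1 ∈ maximalIdeal S ^ (N + 1)
      rw [pow_succ']
      exact Ideal.mul_mem_mul hα y.2
    · intro hx
      obtain ⟨y, hy, hyx⟩ := hex _ hx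
      exact ⟨⟨y, hy⟩, Subtype.ext hyx⟩
  have hspan : α • (⊤ : Submodule S S) = Ideal.span {α} := by
    ext x
    rw [mem_smul_top_iff, Ideal.mem_span_singleton']
    simp [mul_comm]
  rw [hAN, hA N le_rfl, hspan] at h
  exact h.symm

open Polynomial in
/-- The localization `R(X)` of `R[X]` at the extension of the maximal ideal contains a parameter
computing the multiplicity, which divides a nonzerodivisor of `R`. -/
theorem exists_flat_local_extension {R : Type u} [CommRing R] [IsLocalRing R] [IsNoetherianRing R]
    {b : R} (hb : b ∈ nonZeroDivisors R) (hbm : b ∈ maximalIdeal R)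
    (hbfin : ∀ n, Module.length R (R ⧸ maximalIdeal R ^ n) ≠ ⊤) {N e : ℕ}
    (hlen : ∀ n ≥ N, Module.length R (R ⧸ maximalIdeal R ^ (n + 1)) =
      Module.length R (R ⧸ maximalIdeal R ^ n) + e) :
    ∃ (S : Type u) (_ : CommRing S) (_ : IsLocalRing S) (_ : Algebra R S) (_ : Module.Flat R S)
      (α c : S) (n : ℕ), IsNoetherianRing S ∧
      (maximalIdeal R).map (algebraMap R S) = maximalIdeal S ∧ α ∈ maximalIdeal S ∧
      α * c = algebraMap R S (b ^ (n + 1)) ∧ Module.length S (S ⧸ Ideal.span {α}) = e := by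
  have hP : ((maximalIdeal R).map (C : R →+* R[X])).IsPrime := Ideal.isPrime_map_C_of_isPrime
  let P := (maximalIdeal R).map (C : R →+* R[X])
  let S := Localization.AtPrime P
  have hflat : Module.Flat R S := Module.Flat.trans R R[X] S
  have hnoeth : IsNoetherianRing S := IsLocalization.isNoetherianRing P.primeCompl S inferInstance
  have hPS : P.map (algebraMap R[X] S) = maximalIdeal S := Localization.AtPrime.map_eq_maximalIdeal
  have hm : (maximalIdeal R).map (algebraMap R S) = maximalIdeal S := by
    exact (Ideal.map_map _ _).symm.trans hPS
  obtain ⟨f, hf⟩ := exists_span_range_coeff_eq (IsNoetherian.noetherian (maximalIdeal R))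
  obtain ⟨N₀, hN₀⟩ := exists_forall_mem_pow_succ_of_forall_mul_mem (maximalIdeal R)
  have hfP : f ∈ P := Ideal.mem_map_C_iff.2 fun i => hf ▸ Ideal.subset_span ⟨i, rfl⟩
  have hα : algebraMap R[X] S f ∈ maximalIdeal S := hPS ▸ Ideal.mem_map_of_mem _ hfP
  have hmem : ∀ {n : ℕ} {g : R[X]}, algebraMap R[X] S g ∈ maximalIdeal S ^ n ↔
      ∃ t ∈ P.primeCompl, t * g ∈ P ^ n := by
    intro n g
    rw [← hPS, ← Ideal.map_pow]
    exact IsLocalization.algebraMap_mem_map_algebraMap_iff P.primeCompl S (P ^ n) g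
  have hunit : ∀ {t : R[X]}, t ∈ P.primeCompl → IsUnit (algebraMap R[X] S t) := fun {t} ht =>
    IsLocalization.map_units S (⟨t, ht⟩ : P.primeCompl)
  have hsup : ∀ n ≥ N₀, ∀ u ∈ maximalIdeal S ^ n, algebraMap R[X] S f * u ∈
      maximalIdeal S ^ (n + 2) → u ∈ maximalIdeal S ^ (n + 1) := by
    intro n hn u hu hfu
    obtain ⟨⟨g, s⟩, hgs⟩ := IsLocalization.surj P.primeCompl u
    obtain ⟨t, ht, htg⟩ := hmem.1 (hgs ▸ Ideal.mul_mem_right _ _ hu :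
      algebraMap R[X] S g ∈ maximalIdeal S ^ n)
    have h1 : algebraMap R[X] S (f * g) ∈ maximalIdeal S ^ (n + 2) := by
      rw [map_mul, ← hgs, ← mul_assoc]
      exact Ideal.mul_mem_right _ _ hfu
    obtain ⟨t', ht', htg'⟩ := hmem.1 h1
    have hPn : ∀ k, P ^ k = (maximalIdeal R ^ k).map C := fun k => (Ideal.map_pow _ _ _).symm
    have h2 : t * t' * g ∈ P ^ (n + 1) := by
      refine (hPn _).ge (mem_map_C_pow_succ_of_mul_mem hf hN₀ hn ((hPn _).le ?_) ((hPn _).le ?_))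
      · rw [mul_right_comm]
        exact Ideal.mul_mem_right _ _ htg
      · rw [show f * (t * t' * g) = t * (t' * (f * g)) by ring]
        exact Ideal.mul_mem_left _ _ htg'
    have h3 : algebraMap R[X] S g ∈ maximalIdeal S ^ (n + 1) :=
      hmem.2 ⟨_, mul_mem ht ht', h2⟩
    rw [← hgs] at h3
    exact (Ideal.mul_unit_mem_iff_mem _ (hunit s.2)).1 h3
  have hlenS : ∀ n, Module.length S (S ⧸ maximalIdeal S ^ n) =
      Module.length R (R ⧸ maximalIdeal R ^ n) := by
    intro n
    have h := (Algebra.TensorProduct.quotIdealMapEquivTensorQuot S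
      (maximalIdeal R ^ n)).toLinearEquiv.length_eq
    rwa [length_baseChange_of_map_maximalIdeal_eq hm, Ideal.map_pow, hm] at h
  have hbS : algebraMap R S b ∈ nonZeroDivisors S := by
    rw [mem_nonZeroDivisors_iff_right]
    intro x hx
    refine Module.Flat.isSMulRegular_of_nonZeroDivisors (M := S) hb ?_
    change b • x = b • 0
    rw [smul_zero, Algebra.smul_def, mul_comm, hx]
  obtain ⟨⟨c, hc⟩, hαe⟩ := length_quotient_span_singleton_eq (N := max N N₀) (e := e) hα
    (hm ▸ Ideal.mem_map_of_mem _ hbm) hbS (fun n => hlenS n ▸ hbfin n)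
    (fun n hn => by rw [hlenS, hlenS, hlen n ((le_max_left _ _).trans hn)])
    (hsup _ (le_max_right _ _))
  exact ⟨S, _, inferInstance, _, hflat, _, c, _, hnoeth, hm, hα, by rw [hc, map_pow], hαe⟩

theorem exists_mem_nonZeroDivisors_of_annihilator_eq_bot {R : Type*} [CommRing R]
    [IsNoetherianRing R] {I : Ideal R} (hI : Module.annihilator R I = ⊥) :
    ∃ b ∈ I, b ∈ nonZeroDivisors R := by
  by_contra! h
  exact (Ideal.bot_lt_annihilator_of_disjoint_nonZeroDivisors (Set.disjoint_left.2 h)).ne' hI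

theorem exists_maximalIdeal_pow_le {R : Type*} [CommRing R] [IsLocalRing R] [IsNoetherianRing R]
    {J : Ideal R} (hJ : Module.length R (R ⧸ J) ≠ ⊤) : ∃ n, maximalIdeal R ^ n ≤ J := by
  have hart : IsArtinian R (R ⧸ J) :=
    (isFiniteLength_iff_isNoetherian_isArtinian.1 (Module.length_ne_top_iff.1 hJ)).2
  obtain ⟨n, hn⟩ := IsArtinian.monotone_stabilizes (R := R) (M := R ⧸ J)
    ⟨fun n => OrderDual.toDual (maximalIdeal R ^ n • ⊤),
      fun a b hab => Submodule.smul_mono_left (Ideal.pow_le_pow_right hab)⟩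
  have h : maximalIdeal R ^ n • (⊤ : Submodule R (R ⧸ J)) = ⊥ := by
    refine Submodule.eq_bot_of_le_smul_of_le_jacobson_bot (maximalIdeal R) _
      (IsNoetherian.noetherian _) ?_ (maximalIdeal_le_jacobson _)
    rw [← mul_smul, ← pow_succ']
    exact le_of_eq (hn (n + 1) n.le_succ)
  refine ⟨n, fun x hx => Ideal.Quotient.eq_zero_iff_mem.1 ?_⟩
  have h1 : x • (1 : R ⧸ J) ∈ maximalIdeal R ^ n • (⊤ : Submodule R (R ⧸ J)) :=
    Submodule.smul_mem_smul hx Submodule.mem_top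
  rw [h, Submodule.mem_bot] at h1
  rw [← h1, Algebra.smul_def, mul_one]
  rfl

theorem length_quotient_ne_top_of_mem {R : Type*} [CommRing R] {J : Ideal R} {x : R} (hx : x ∈ J)
    (h : Module.length R (R ⧸ Ideal.span {x}) ≠ ⊤) : Module.length R (R ⧸ J) ≠ ⊤ :=
  ne_top_of_le_ne_top h (Module.length_le_of_surjective
    (Submodule.factor ((Ideal.span_singleton_le_iff_mem _).2 hx)) (Submodule.factor_surjective _))

end

/-- (Corollary 3.4) Let `R` be a one-dimensional Gorenstein local ring with
`e(R) ≤ 6` and `I` a faithful ideal. If `I ⊗_R Hom_R(I, R)` is torsionfree, then `I` is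
principal. Here Gorenstein means that `R` is a canonical module of itself. -/
theorem stmt7 (R : Type u) [CommRing R] [IsLocalRing R]
    (hNoeth : IsNoetherianRing R) (hdim : ringKrullDim R = 1)
    (hGor : IsCanonicalModuleAt R (IsLocalRing.maximalIdeal R) R)
    (he : ∃ e : ℕ, IsMultiplicityAt R (IsLocalRing.maximalIdeal R) e ∧ e ≤ 6)
    (I : Ideal R) (hfaith : Module.annihilator R ↥I = ⊥)
    (htf : Submodule.torsion R (↥I ⊗[R] (↥I →ₗ[R] R)) = ⊥) :
    ∃ x : R, I = Ideal.span {x} := by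
  by_contra hI
  obtain ⟨e, ⟨N, hN⟩, he6⟩ := he
  have hdim' : Ring.KrullDimLE 1 R := Ring.krullDimLE_iff.2 hdim.le
  have hfin : ∀ {a : R}, a ∈ nonZeroDivisors R → Module.length R (R ⧸ Ideal.span {a}) ≠ ⊤ :=
    fun ha => Module.length_ne_top_iff.2 (isFiniteLength_quotient_span_singleton R ha)
  have hR : IsGorensteinDual R :=
    ⟨fun ha f => exists_lift_maximalIdeal (hGor.2.1 2 (by decide)) ha f,
      fun ha => exists_maximalIdeal_pow_le (hfin ha)⟩
  obtain ⟨b, hbI, hb⟩ := exists_mem_nonZeroDivisors_of_annihilator_eq_bot hfaith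
  have hann : Module.annihilator R (IsLocalRing.maximalIdeal R) = ⊥ := by
    refine (Submodule.eq_bot_iff _).2 fun x hx => ?_
    refine eq_zero_of_forall_maximalIdeal_mul_eq_zero (hGor.2.1 0 (by decide)) fun c hc => ?_
    rw [mul_comm]
    exact congrArg Subtype.val (Module.mem_annihilator.1 hx ⟨c, hc⟩)
  obtain ⟨d, hdm, hd⟩ := exists_mem_nonZeroDivisors_of_annihilator_eq_bot hann
  have hfinpow : ∀ n, Module.length R (R ⧸ IsLocalRing.maximalIdeal R ^ n) ≠ ⊤ := fun n =>
    length_quotient_ne_top_of_mem (Ideal.pow_mem_pow hdm n) (hfin (pow_mem hd n))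
  obtain ⟨S, _, _, _, _, α, c, n, _, hm, hα, hαc, hαe⟩ := exists_flat_local_extension hd hdm hfinpow
    (N := N) (e := e) fun n hn => by
      simpa only [moduleLength, ← Module.length_eq_height] using hN n hn
  have ha : d ^ (n + 1) ∈ nonZeroDivisors R := pow_mem hd _
  have ham : d ^ (n + 1) ∈ IsLocalRing.maximalIdeal R := Ideal.pow_mem_of_mem _ hdm _ n.succ_pos
  refine false_of_flat_of_length_le_six hm ha hb hbI (hfin hb)
    (hR.endLifts ha hb hbI (evalMap_injective_of_torsion_eq_bot hb hbI htf)) ?_ hI hαc hα he6 hαe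
  by_contra! hlt
  exact hI (hR.exists_eq_span_singleton ha ham hb hbI
    (length_quotient_ne_top_of_mem hbI (hfin hb)) (hfin ha) (Order.le_of_lt_add_one hlt))

end
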